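/- For every real c < 1/(2 ln 2) there exists an integer M such that for every integer m ≥ M one has H(m,m) ≥ c·(m+2)·ln(m+2); that is, liminf_{m→∞} H(m,m)/((m+2)·ln(m+2)) ≥ 1/(2 ln 2). -/

import Mathlib

open Filter Polynomial

/-- `Γ` is a periodic orbit of the planar vector field `V`: the image of a
nonconstant periodic solution of `γ' = V ∘ γ`. -/
def IsPeriodicOrbit (V : ℝ × ℝ → ℝ × ℝ) (Γ : Set (ℝ × ℝ)) : Prop :=
  ∃ γ : ℝ → ℝ × ℝ,
    (∀ t : ℝ, HasDerivAt γ (V (γ t)) t) ∧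
    (∃ T : ℝ, 0 < T ∧ Function.Periodic γ T) ∧
    (∃ t₁ t₂ : ℝ, γ t₁ ≠ γ t₂) ∧
    Γ = Set.range γ

/-- `Γ` is a limit cycle of `V`: a periodic orbit which is isolated among
periodic orbits. -/
def IsLimitCycle (V : ℝ × ℝ → ℝ × ℝ) (Γ : Set (ℝ × ℝ)) : Prop :=
  IsPeriodicOrbit V Γ ∧
  ∃ U : Set (ℝ × ℝ), IsOpen U ∧ Γ ⊆ U ∧
    ∀ Γ' : Set (ℝ × ℝ), IsPeriodicOrbit V Γ' → Γ' ⊆ U → Γ' = Γ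

/-- The Liénard vector field `ẋ = y, ẏ = -g(x) - ε f(x) y`. -/
def lienard (f g : Polynomial ℝ) (ε : ℝ) : ℝ × ℝ → ℝ × ℝ :=
  fun p => (p.2, -(g.eval p.1) - ε * (f.eval p.1) * p.2)

/-- `HGe n m c` formalizes `H(n,m) ≥ c`: there are polynomials `f, g` with
`deg f ≤ n`, `deg g ≤ m` and `ε₀ > 0` such that for every `0 < ε ≤ ε₀` the
Liénard system has at least `c` pairwise distinct limit cycles. -/
def HGe (n m : ℕ) (c : ℝ) : Prop :=
  ∃ f g : Polynomial ℝ, f.natDegree ≤ n ∧ g.natDegree ≤ m ∧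
    ∃ ε₀ : ℝ, 0 < ε₀ ∧ ∀ ε : ℝ, 0 < ε → ε ≤ ε₀ →
      ∃ S : Finset (Set (ℝ × ℝ)),
        (∀ Γ ∈ S, IsLimitCycle (lienard f g ε) Γ) ∧ c ≤ (S.card : ℝ)


open Real Set Topology

/-! ### Clockwise polar coordinates

Around the centre `(c, 0)` write `x = c + r cos θ`, `y = -r sin θ`. -/

/-- The energy `y² / 2 + G(x)` in polar coordinates. -/
noncomputable def polarEnergy (G : ℝ[X]) (c r θ : ℝ) : ℝ :=
  r ^ 2 * sin θ ^ 2 / 2 + G.eval (c + r * cos θ)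

/-- The radial derivative of `polarEnergy`, with `g` the derivative of `G`. -/
noncomputable def radialDeriv (g : ℝ[X]) (c r θ : ℝ) : ℝ :=
  r * sin θ ^ 2 + cos θ * g.eval (c + r * cos θ)

/-- `r` times the angular velocity of the Liénard field. -/
noncomputable def angularSpeed (f g : ℝ[X]) (c ε r θ : ℝ) : ℝ :=
  r * sin θ ^ 2 + cos θ * (g.eval (c + r * cos θ) - ε * (f.eval (c + r * cos θ) * (r * sin θ)))

/-- The rate of energy loss, per unit of angle and of `ε`. -/
noncomputable def energyLoss (f g : ℝ[X]) (c ε r θ : ℝ) : ℝ :=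
  f.eval (c + r * cos θ) * r ^ 3 * sin θ ^ 2 / angularSpeed f g c ε r θ

/-- The point with polar coordinates `(r, θ)`. -/
noncomputable def polarPoint (c r θ : ℝ) : ℝ × ℝ := (c + r * cos θ, -(r * sin θ))

/-- `R` is a positive solution of the integrated energy equation along which the angular
speed and the radial derivative of the energy are positive. -/
structure IsPolarSolution (f g G : ℝ[X]) (c ε h : ℝ) (R : ℝ → ℝ) : Prop where
  continuous : Continuous R
  pos : ∀ θ, 0 < R θ
  speed_pos : ∀ θ, 0 < angularSpeed f g c ε (R θ) θ
  radial_pos : ∀ θ, 0 < radialDeriv g c (R θ) θ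
  energy : ∀ θ, polarEnergy G c (R θ) θ = h - ε * ∫ s in (0 : ℝ)..θ, energyLoss f g c ε (R s) s

lemma continuous_angularSpeed (f g : ℝ[X]) (c : ℝ) :
    Continuous fun p : ℝ × ℝ × ℝ => angularSpeed f g c p.1 p.2.1 p.2.2 := by
  unfold angularSpeed; fun_prop

lemma continuous_radialDeriv (g : ℝ[X]) (c : ℝ) :
    Continuous fun p : ℝ × ℝ => radialDeriv g c p.1 p.2 := by
  unfold radialDeriv; fun_prop

lemma continuous_polarEnergy (G : ℝ[X]) (c : ℝ) :
    Continuous fun p : ℝ × ℝ => polarEnergy G c p.1 p.2 := by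
  unfold polarEnergy; fun_prop

lemma hasStrictDerivAt_of_implicit {Ψ : ℝ × ℝ → ℝ} {R : ℝ → ℝ} {θ a b : ℝ}
    (hΨ : HasStrictFDerivAt Ψ (a • ContinuousLinearMap.fst ℝ ℝ ℝ +
      b • ContinuousLinearMap.snd ℝ ℝ ℝ) (θ, R θ))
    (hR : ContinuousAt R θ) (hb : b ≠ 0) (h0 : ∀ᶠ t in 𝓝 θ, Ψ (t, R t) = Ψ (θ, R θ)) :
    HasDerivAt R (-a / b) θ := by
  have hinv : ((a • ContinuousLinearMap.fst ℝ ℝ ℝ + b • ContinuousLinearMap.snd ℝ ℝ ℝ) ∘L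
      .inr ℝ ℝ ℝ).IsInvertible := by
    refine ⟨ContinuousLinearEquiv.unitsEquivAut ℝ (Units.mk0 b hb), ?_⟩
    ext; simp
  have h1 := hΨ.eventually_apply_eq_iff_implicitFunctionOfProdDomain hinv
  have h2 := (hΨ.hasStrictFDerivAt_implicitFunctionOfProdDomain hinv).hasFDerivAt
  have hc : Tendsto (fun t => (t, R t)) (𝓝 θ) (𝓝 (θ, R θ)) :=
    (continuousAt_id.prodMk hR).tendsto
  have h3 : R =ᶠ[𝓝 θ] hΨ.implicitFunctionOfProdDomain hinv := by
    filter_upwards [hc.eventually h1, h0] with t ht ht0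
    exact (ht.1 ht0).symm
  have hd : DifferentiableAt ℝ R θ := (h2.differentiableAt).congr_of_eventuallyEq h3
  have h4 : HasDerivAt (fun t => Ψ (t, R t)) (a + b * deriv R θ) θ := by
    have := hΨ.hasFDerivAt.comp_hasDerivAt θ ((hasDerivAt_id θ).prodMk hd.hasDerivAt)
    convert! this using 1
    simp
  have h5 : HasDerivAt (fun t => Ψ (t, R t)) 0 θ :=
    (hasDerivAt_const θ (Ψ (θ, R θ))).congr_of_eventuallyEq h0
  have h6 := h4.unique h5
  have : deriv R θ = -a / b := by field_simp; linarith
  rw [← this]; exact hd.hasDerivAt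

namespace IsPolarSolution

variable {f g G : ℝ[X]} {c ε h : ℝ} {R : ℝ → ℝ}

lemma continuous_speed (hR : IsPolarSolution f g G c ε h R) :
    Continuous fun θ => angularSpeed f g c ε (R θ) θ :=
  (continuous_angularSpeed f g c).comp
    (continuous_const.prodMk (hR.continuous.prodMk continuous_id))

lemma continuous_loss (hR : IsPolarSolution f g G c ε h R) :
    Continuous fun θ => energyLoss f g c ε (R θ) θ := by
  unfold energyLoss
  have := hR.continuous
  exact Continuous.div (by fun_prop) hR.continuous_speed fun θ => (hR.speed_pos θ).ne'

/-- The radial equation. -/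
lemma hasDerivAt (hG : derivative G = g) (hR : IsPolarSolution f g G c ε h R) (θ : ℝ) :
    HasDerivAt R (R θ * sin θ * (g.eval (c + R θ * cos θ) - R θ * cos θ
      - ε * (f.eval (c + R θ * cos θ) * (R θ * sin θ))) / angularSpeed f g c ε (R θ) θ) θ := by
  set k : ℝ → ℝ := fun θ => h - ε * ∫ s in (0 : ℝ)..θ, energyLoss f g c ε (R s) s with hk
  have hk' : HasStrictDerivAt k (-(ε * energyLoss f g c ε (R θ) θ)) θ := by
    have := intervalIntegral.integral_hasStrictDerivAt_right
      (hR.continuous_loss.intervalIntegrable 0 θ)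
      (hR.continuous_loss.stronglyMeasurableAtFilter _ _) hR.continuous_loss.continuousAt
    convert! (hasStrictDerivAt_const θ h).sub (this.const_mul ε) using 1
    simp
  set E := radialDeriv g c (R θ) θ with hE
  set Eθ := R θ ^ 2 * sin θ * cos θ - R θ * sin θ * g.eval (c + R θ * cos θ) with hEθ
  have hΨ : HasStrictFDerivAt (fun p : ℝ × ℝ => polarEnergy G c p.2 p.1 - k p.1)
      ((Eθ + ε * energyLoss f g c ε (R θ) θ) • ContinuousLinearMap.fst ℝ ℝ ℝ +
      E • ContinuousLinearMap.snd ℝ ℝ ℝ) (θ, R θ) := by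
    have hr : HasStrictFDerivAt (fun p : ℝ × ℝ => p.2) (.snd ℝ ℝ ℝ) (θ, R θ) :=
      hasStrictFDerivAt_snd
    have ht : HasStrictFDerivAt (fun p : ℝ × ℝ => p.1) (.fst ℝ ℝ ℝ) (θ, R θ) :=
      hasStrictFDerivAt_fst
    have hs := (hasStrictDerivAt_sin θ).comp_hasStrictFDerivAt_of_eq (θ, R θ) ht rfl
    have hc := (hasStrictDerivAt_cos θ).comp_hasStrictFDerivAt_of_eq (θ, R θ) ht rfl
    have hx := (hr.mul hc).const_add c
    have hGx := (G.hasStrictDerivAt (c + R θ * cos θ)).comp_hasStrictFDerivAt_of_eq (θ, R θ) hx rfl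
    have hkx := hk'.comp_hasStrictFDerivAt_of_eq (θ, R θ) ht rfl
    have := ((((hr.pow 2).mul (hs.pow 2)).mul_const (1 / 2)).add hGx).sub hkx
    convert! this using 1
    · ext p; simp [polarEnergy]; ring
    · rw [hG]
      ext <;> simp [hE, hEθ, radialDeriv] <;> ring
  have hE0 : E ≠ 0 := (hR.radial_pos θ).ne'
  have := hasStrictDerivAt_of_implicit hΨ hR.continuous.continuousAt hE0
    (Eventually.of_forall fun t => by
      simp only [hk]
      rw [hR.energy t, hR.energy θ]; ring)
  convert! this using 1
  have hw := (hR.speed_pos θ).ne'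
  rw [div_eq_div_iff hw hE0, energyLoss, hE, hEθ]
  field_simp
  rw [radialDeriv, angularSpeed]
  linear_combination (-(ε * f.eval (c + R θ * cos θ) * R θ ^ 3 * sin θ ^ 2)) *
    (sin_sq_add_cos_sq θ)

end IsPolarSolution

/-! ### Changes of time -/

lemma exists_inverse_of_deriv_ge {τ v : ℝ → ℝ} (hτ : ∀ s, HasDerivAt τ (v s) s) {m : ℝ}
    (hm : 0 < m) (hv : ∀ s, m ≤ v s) :
    ∃ σ : ℝ → ℝ, (∀ t, τ (σ t) = t) ∧ (∀ s, σ (τ s) = s) ∧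
      ∀ t, HasDerivAt σ (v (σ t))⁻¹ t := by
  have hmono : StrictMono τ := strictMono_of_deriv_pos fun s => by
    rw [(hτ s).deriv]; exact hm.trans_le (hv s)
  have hcont : Continuous τ := continuous_iff_continuousAt.2 fun s => (hτ s).continuousAt
  have hlin : Monotone fun s => τ s - m * s := by
    have hd : ∀ s, HasDerivAt (fun s => τ s - m * s) (v s - m) s := fun s => by
      simpa using (hτ s).fun_sub ((hasDerivAt_id' s).const_mul m)
    refine monotone_of_deriv_nonneg (fun s => (hd s).differentiableAt) fun s => ?_
    rw [(hd s).deriv]; linarith [hv s]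
  have htop : Tendsto τ atTop atTop := by
    refine tendsto_atTop_mono' _ ?_ ((tendsto_id.const_mul_atTop hm).atTop_add
      (tendsto_const_nhds (x := τ 0)))
    filter_upwards [eventually_ge_atTop 0] with s hs
    have := hlin hs; simp at this ⊢; linarith
  have hbot : Tendsto τ atBot atBot := by
    refine tendsto_atBot_mono' _ ?_ ((tendsto_id.const_mul_atBot hm).atBot_add
      (tendsto_const_nhds (x := τ 0)))
    filter_upwards [eventually_le_atBot 0] with s hs
    have := hlin hs; simp at this ⊢; linarith
  have hsurj : Function.Surjective τ := hcont.surjective htop hbot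
  let e := hmono.orderIsoOfSurjective τ hsurj
  refine ⟨e.symm, fun t => e.apply_symm_apply t, fun s => e.symm_apply_apply s, fun t => ?_⟩
  refine HasDerivAt.of_local_left_inverse (f := τ) e.symm.continuous.continuousAt (hτ _)
    (hm.trans_le (hv _)).ne' (Eventually.of_forall fun t => e.apply_symm_apply t)

namespace IsPolarSolution

variable {f g G : ℝ[X]} {c ε h : ℝ} {R : ℝ → ℝ}

lemma hasDerivAt_polarPoint (hG : derivative G = g) (hR : IsPolarSolution f g G c ε h R) (θ : ℝ) :
    HasDerivAt (fun θ => polarPoint c (R θ) θ)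
      ((R θ / angularSpeed f g c ε (R θ) θ) • lienard f g ε (polarPoint c (R θ) θ)) θ := by
  have h1 := hR.hasDerivAt hG θ
  have hx := (h1.mul (hasDerivAt_cos θ)).const_add c
  have hy := (h1.mul (hasDerivAt_sin θ)).neg
  have hw := (hR.speed_pos θ).ne'
  have := hx.prodMk hy
  convert! this using 1
  ext
  · simp only [lienard, polarPoint, Prod.smul_mk, smul_eq_mul]
    field_simp
    rw [angularSpeed]
    linear_combination (R θ ^ 2 * sin θ) * (sin_sq_add_cos_sq θ)
  · simp only [lienard, polarPoint, Prod.smul_mk, smul_eq_mul]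
    field_simp
    rw [angularSpeed]
    linear_combination (R θ) * (g.eval (c + R θ * cos θ)
      - ε * (f.eval (c + R θ * cos θ) * (R θ * sin θ))) * (sin_sq_add_cos_sq θ)

lemma exists_lower_bound {v : ℝ → ℝ} (hc : Continuous v) {T : ℝ} (hT : 0 < T)
    (hp : Function.Periodic v T) (hpos : ∀ s, 0 < v s) : ∃ m, 0 < m ∧ ∀ s, m ≤ v s := by
  obtain ⟨s₀, -, h₀⟩ := isCompact_Icc.exists_isMinOn (nonempty_Icc.2 hT.le) hc.continuousOn
  refine ⟨v s₀, hpos _, fun s => ?_⟩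
  obtain ⟨y, hy, he⟩ := hp.exists_mem_Ico₀ hT s
  rw [he]; exact h₀ (Ico_subset_Icc_self hy)

lemma isPeriodicOrbit (hG : derivative G = g) (hR : IsPolarSolution f g G c ε h R)
    (hper : Function.Periodic R (2 * π)) :
    IsPeriodicOrbit (lienard f g ε) (range fun θ => polarPoint c (R θ) θ) := by
  have hRc := hR.continuous
  set v : ℝ → ℝ := fun θ => R θ / angularSpeed f g c ε (R θ) θ with hv
  have hvc : Continuous v := hRc.div hR.continuous_speed fun θ => (hR.speed_pos θ).ne'
  have hvp : Function.Periodic v (2 * π) := fun θ => by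
    simp only [hv, angularSpeed, hper θ, sin_add_two_pi, cos_add_two_pi]
  have hvpos : ∀ θ, 0 < v θ := fun θ => div_pos (hR.pos θ) (hR.speed_pos θ)
  obtain ⟨m, hm, hmv⟩ := exists_lower_bound hvc two_pi_pos hvp hvpos
  set τ : ℝ → ℝ := fun θ => ∫ s in (0 : ℝ)..θ, v s with hτ
  have hτd : ∀ θ, HasDerivAt τ (v θ) θ := fun θ => hvc.integral_hasStrictDerivAt 0 θ |>.hasDerivAt
  obtain ⟨σ, h1, h2, h3⟩ := exists_inverse_of_deriv_ge hτd hm hmv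
  refine ⟨fun t => polarPoint c (R (σ t)) (σ t), fun t => ?_, ⟨τ (2 * π), ?_, fun t => ?_⟩,
    ⟨τ 0, τ π, ?_⟩, ?_⟩
  · have := (hR.hasDerivAt_polarPoint hG (σ t)).scomp t (h3 t)
    convert! this using 1
    rw [smul_smul, inv_mul_cancel₀ (hvpos _).ne', one_smul]
  · exact intervalIntegral.intervalIntegral_pos_of_pos (hvc.intervalIntegrable _ _) hvpos two_pi_pos
  · have hs : σ (t + τ (2 * π)) = σ t + 2 * π := by
      rw [← h2 (σ t + 2 * π)]
      congr 1
      have := hvp.intervalIntegral_add_eq 0 (σ t)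
      simp only [hτ, zero_add] at this ⊢
      have h0 : t = ∫ s in (0 : ℝ)..(σ t), v s := (h1 t).symm
      rw [this]
      nth_rewrite 1 [h0]
      rw [intervalIntegral.integral_add_adjacent_intervals
        (hvc.intervalIntegrable _ _) (hvc.intervalIntegrable _ _)]
    simp only [hs, polarPoint, hper (σ t), sin_add_two_pi, cos_add_two_pi]
  · simp only [h2, polarPoint, ne_eq, Prod.mk.injEq, cos_zero, cos_pi, sin_zero, sin_pi]
    intro hh
    linarith [hR.pos 0, hR.pos π, hh.1]
  · ext p; constructor
    · rintro ⟨θ, rfl⟩; exact ⟨τ θ, by simp [h2]⟩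
    · rintro ⟨t, rfl⟩; exact ⟨σ t, rfl⟩

end IsPolarSolution

/-! ### Lifting orbits to polar coordinates -/

lemma polarPoint_eq_iff {c r θ r' θ' : ℝ} (hr : 0 < r) (hr' : 0 < r')
    (h : polarPoint c r θ = polarPoint c r' θ') : r = r' ∧ ∃ n : ℤ, θ = θ' + n * (2 * π) := by
  simp only [polarPoint, Prod.mk.injEq, add_right_inj, neg_inj] at h
  have hrr : r = r' := by
    have : r ^ 2 = r' ^ 2 := by
      have h1 := sin_sq_add_cos_sq θ
      have h2 := sin_sq_add_cos_sq θ'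
      calc r ^ 2 = (r * cos θ) ^ 2 + (r * sin θ) ^ 2 := by linear_combination (-r ^ 2) * h1
        _ = (r' * cos θ') ^ 2 + (r' * sin θ') ^ 2 := by rw [h.1, h.2]
        _ = r' ^ 2 := by linear_combination (r' ^ 2) * h2
    exact (pow_left_inj₀ hr.le hr'.le two_ne_zero).1 this
  refine ⟨hrr, ?_⟩
  subst hrr
  obtain ⟨h1, h2⟩ := h
  have h1 := mul_left_cancel₀ hr.ne' h1
  have h2 := mul_left_cancel₀ hr.ne' h2
  have : (θ : Real.Angle) = θ' := Real.Angle.cos_sin_inj h1 h2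
  obtain ⟨n, hn⟩ := Real.Angle.angle_eq_iff_two_pi_dvd_sub.1 this
  exact ⟨n, by linarith⟩

lemma polarPoint_add_int (c r θ : ℝ) (n : ℤ) :
    polarPoint c r (θ + n * (2 * π)) = polarPoint c r θ := by
  simp [polarPoint]

lemma polarPoint_eq_exp (c r θ : ℝ) (hr : 0 < r) :
    Complex.exp (Real.log r + θ * Complex.I) =
      (((polarPoint c r θ).1 - c : ℝ) : ℂ) - ((polarPoint c r θ).2 : ℝ) * Complex.I := by
  rw [Complex.exp_add, Complex.exp_mul_I, ← Complex.ofReal_exp, Real.exp_log hr]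
  simp [polarPoint]; ring

/-- The set of points whose polar radius is `δ`-close to `R`. -/
def polarTube (c : ℝ) (R : ℝ → ℝ) (δ : ℝ) : Set (ℝ × ℝ) :=
  {p | ∃ r θ, 0 < r ∧ |r - R θ| < δ ∧ p = polarPoint c r θ}

lemma isOpen_polarTube (c : ℝ) {R : ℝ → ℝ} (hR : Continuous R) (δ : ℝ) :
    IsOpen (polarTube c R δ) := by
  have hW : IsOpen {L : ℂ | |Real.exp L.re - R L.im| < δ} :=
    isOpen_lt (by fun_prop) continuous_const
  have := (Complex.isOpenMap_exp _ hW).preimage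
    (f := fun p : ℝ × ℝ => ((p.1 - c : ℝ) : ℂ) - (p.2 : ℝ) * Complex.I) (by fun_prop)
  convert this using 1
  ext p; constructor
  · rintro ⟨r, θ, hr, hd, rfl⟩
    exact ⟨Real.log r + θ * Complex.I, by simpa [Real.exp_log hr] using hd,
      polarPoint_eq_exp c r θ hr⟩
  · rintro ⟨L, hL, he⟩
    refine ⟨Real.exp L.re, L.im, Real.exp_pos _, hL, ?_⟩
    have h2 := polarPoint_eq_exp c (Real.exp L.re) L.im (Real.exp_pos _)
    rw [Real.log_exp, Complex.re_add_im, he] at h2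
    have hre := congrArg Complex.re h2
    have him := congrArg Complex.im h2
    simp at hre him
    exact Prod.ext hre him

lemma hasDerivAt_comp_fst {γ : ℝ → ℝ × ℝ} {v : ℝ × ℝ} {t : ℝ} (h : HasDerivAt γ v t) :
    HasDerivAt (fun t => (γ t).1) v.1 t :=
  ((ContinuousLinearMap.fst ℝ ℝ ℝ).hasFDerivAt (x := γ t)).comp_hasDerivAt t h

lemma hasDerivAt_comp_snd {γ : ℝ → ℝ × ℝ} {v : ℝ × ℝ} {t : ℝ} (h : HasDerivAt γ v t) :
    HasDerivAt (fun t => (γ t).2) v.2 t :=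
  ((ContinuousLinearMap.snd ℝ ℝ ℝ).hasFDerivAt (x := γ t)).comp_hasDerivAt t h

lemma exists_polar_lift {f g : ℝ[X]} {c ε : ℝ} {γ : ℝ → ℝ × ℝ}
    (hγ : ∀ t, HasDerivAt γ (lienard f g ε (γ t)) t)
    (hc : ∀ t, γ t ≠ (c, 0)) :
    ∃ ρ θ : ℝ → ℝ, Continuous ρ ∧ (∀ t, 0 < ρ t) ∧ (∀ t, γ t = polarPoint c (ρ t) (θ t)) ∧
      ∀ t, HasDerivAt θ (angularSpeed f g c ε (ρ t) (θ t) / ρ t) t := by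
  have hγc : Continuous γ := continuous_iff_continuousAt.2 fun t => (hγ t).continuousAt
  set z : ℝ → ℂ := fun t => (((γ t).1 - c : ℝ) : ℂ) - ((γ t).2 : ℝ) * Complex.I with hz
  set z' : ℝ → ℂ := fun t => (((lienard f g ε (γ t)).1 : ℝ) : ℂ)
    - ((lienard f g ε (γ t)).2 : ℝ) * Complex.I with hz'
  have hzd : ∀ t, HasDerivAt z (z' t) t := fun t => by
    have hx : HasDerivAt (fun t => (γ t).1) (lienard f g ε (γ t)).1 t :=
      hasDerivAt_comp_fst (hγ t)
    have hy : HasDerivAt (fun t => (γ t).2) (lienard f g ε (γ t)).2 t :=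
      hasDerivAt_comp_snd (hγ t)
    have h1 := (hx.sub_const c).ofReal_comp
    have h2 := (hy.ofReal_comp).mul_const Complex.I
    exact h1.sub h2
  have hz0 : ∀ t, z t ≠ 0 := fun t h0 => by
    have hre := congrArg Complex.re h0
    have him := congrArg Complex.im h0
    simp [hz] at hre him
    exact hc t (Prod.ext (by linarith) him)
  have hzc : Continuous z := by fun_prop
  have hz'c : Continuous z' := by simp only [hz', lienard]; fun_prop
  have hq : Continuous fun t => z' t / z t := hz'c.div hzc hz0
  set L : ℝ → ℂ := fun t => Complex.log (z 0) + ∫ s in (0 : ℝ)..t, z' s / z s with hL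
  have hLd : ∀ t, HasDerivAt L (z' t / z t) t := fun t =>
    ((hq.integral_hasStrictDerivAt 0 t).hasDerivAt).const_add _
  have hexp : ∀ t, Complex.exp (L t) = z t := by
    have hd : ∀ t, HasDerivAt (fun t => z t * Complex.exp (-L t)) 0 t := fun t => by
      have := (hzd t).fun_mul ((hLd t).fun_neg.cexp)
      convert! this using 1
      field_simp [hz0 t]; ring
    have hk := is_const_of_deriv_eq_zero (fun t => (hd t).differentiableAt) fun t => (hd t).deriv
    intro t
    have h1 := hk t 0
    have h2 : L 0 = Complex.log (z 0) := by simp [hL]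
    simp only [h2, Complex.exp_neg, Complex.exp_log (hz0 0), mul_inv_cancel₀ (hz0 0)] at h1
    field_simp [Complex.exp_ne_zero] at h1
    exact h1.symm
  have hLc : Continuous L := continuous_iff_continuousAt.2 fun t => (hLd t).continuousAt
  have hpp : ∀ t, γ t = polarPoint c (Real.exp (L t).re) (L t).im := fun t => by
    have h2 := polarPoint_eq_exp c (Real.exp (L t).re) (L t).im (Real.exp_pos _)
    rw [Real.log_exp, Complex.re_add_im, hexp] at h2
    have hre := congrArg Complex.re h2
    have him := congrArg Complex.im h2
    simp [hz] at hre him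
    exact Prod.ext hre him
  refine ⟨fun t => Real.exp (L t).re, fun t => (L t).im, by fun_prop, fun t => Real.exp_pos _,
    hpp, fun t => ?_⟩
  have := (Complex.imCLM.hasFDerivAt (x := L t)).comp_hasDerivAt t (hLd t)
  convert! this using 1
  simp only [Complex.imCLM_apply]
  set r := Real.exp (L t).re with hr
  set φ := (L t).im with hφ
  have hrpos : 0 < r := Real.exp_pos _
  have hzt : z t = (r * cos φ : ℝ) + (r * sin φ : ℝ) * Complex.I := by
    simp only [hz, hpp t, polarPoint, ← hr, ← hφ]; push_cast; ring
  have hzt' : z' t = (-(r * sin φ) : ℝ) + ((g.eval (c + r * cos φ)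
      - ε * (f.eval (c + r * cos φ) * (r * sin φ)) : ℝ)) * Complex.I := by
    simp only [hz', hpp t, polarPoint, lienard, ← hr, ← hφ]; push_cast; ring
  have hns : Complex.normSq (z t) = r ^ 2 := by
    rw [hzt, Complex.normSq_add_mul_I]
    linear_combination r ^ 2 * (sin_sq_add_cos_sq φ)
  rw [Complex.div_im, hns, hzt, hzt', angularSpeed]
  simp only [Complex.add_re, Complex.add_im, Complex.mul_re, Complex.mul_im, Complex.ofReal_re,
    Complex.ofReal_im, Complex.I_re, Complex.I_im]
  field_simp
  ring

lemma lienard_solution_unique {f g : ℝ[X]} {ε : ℝ} {γ₁ γ₂ : ℝ → ℝ × ℝ}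
    (h₁ : ∀ t, HasDerivAt γ₁ (lienard f g ε (γ₁ t)) t)
    (h₂ : ∀ t, HasDerivAt γ₂ (lienard f g ε (γ₂ t)) t)
    {K : Set (ℝ × ℝ)} (hK : Bornology.IsBounded K) (hK₁ : ∀ t, γ₁ t ∈ K) (hK₂ : ∀ t, γ₂ t ∈ K)
    {t₀ : ℝ} (h₀ : γ₁ t₀ = γ₂ t₀) : γ₁ = γ₂ := by
  obtain ⟨r, hr⟩ := hK.subset_closedBall 0
  have hV : ContDiff ℝ 1 (lienard f g ε) := by
    unfold lienard
    have e1 : ContDiff ℝ 1 fun p : ℝ × ℝ => f.eval p.1 := (f.contDiff_aeval 1).comp contDiff_fst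
    have e2 : ContDiff ℝ 1 fun p : ℝ × ℝ => g.eval p.1 := (g.contDiff_aeval 1).comp contDiff_fst
    fun_prop
  obtain ⟨L, hL⟩ := (hV.contDiffOn (s := Metric.closedBall 0 r)).exists_lipschitzOnWith
    one_ne_zero (convex_closedBall 0 r) (isCompact_closedBall 0 r)
  exact ODE_solution_unique_univ (v := fun _ => lienard f g ε)
    (s := fun _ => Metric.closedBall 0 r) (fun _ => hL)
    (fun t => ⟨h₁ t, hr (hK₁ t)⟩) (fun t => ⟨h₂ t, hr (hK₂ t)⟩) h₀

lemma exists_eq_add_of_periodic {R : ℝ → ℝ} (hR : Continuous R) {T : ℝ} {k : ℕ} (hk : k ≠ 0)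
    (hp : Function.Periodic R (k * T)) : ∃ x, R (x + T) = R x := by
  by_contra! hne
  have hsum : ∑ i ∈ Finset.range k, (R (i * T + T) - R (i * T)) = 0 := by
    have := Finset.sum_range_sub (fun i : ℕ => R (i * T)) k
    simp only [Nat.cast_add, Nat.cast_one, add_mul, one_mul] at this
    rw [this]
    have := hp 0
    simp at this; simp [this]
  have hc : Continuous fun x => R (x + T) - R x := by fun_prop
  have hs : (∀ x, 0 < R (x + T) - R x) ∨ ∀ x, R (x + T) - R x < 0 := by
    by_contra! hcon
    obtain ⟨⟨x, hx⟩, ⟨y, hy⟩⟩ := hcon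
    obtain ⟨w, hw⟩ := mem_range_of_exists_le_of_exists_ge hc ⟨x, hx⟩ ⟨y, hy⟩
    exact hne w (by simpa [sub_eq_zero] using hw)
  have hne : (Finset.range k).Nonempty := by simpa using hk
  rcases hs with hs | hs
  · exact (Finset.sum_pos (fun (i : ℕ) _ => hs (i * T)) hne).ne' hsum
  · exact (Finset.sum_neg (fun (i : ℕ) _ => hs (i * T)) hne).ne hsum

/-- A periodic orbit staying where the polar equation is regular is the graph of a
`2π`-periodic polar solution. -/
lemma exists_isPolarSolution {f g G : ℝ[X]} (hG : derivative G = g) {c ε : ℝ}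
    {R₀ : ℝ → ℝ} {δ : ℝ} (hR₀ : Function.Periodic R₀ (2 * π))
    (hw : ∀ r θ, |r - R₀ θ| < δ → 0 < r → 0 < angularSpeed f g c ε r θ)
    (hr : ∀ r θ, |r - R₀ θ| < δ → 0 < r → 0 < radialDeriv g c r θ)
    {Γ : Set (ℝ × ℝ)} (hΓ : IsPeriodicOrbit (lienard f g ε) Γ) (hU : Γ ⊆ polarTube c R₀ δ) :
    ∃ h R, IsPolarSolution f g G c ε h R ∧ Function.Periodic R (2 * π) ∧
      (∀ θ, |R θ - R₀ θ| < δ) ∧ Γ = range fun θ => polarPoint c (R θ) θ := by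
  obtain ⟨γ, hγ, ⟨T, hT, hγT⟩, -, rfl⟩ := hΓ
  have hc : ∀ t, γ t ≠ (c, 0) := fun t h0 => by
    obtain ⟨r, θ, hr, -, hp⟩ := hU ⟨t, rfl⟩
    rw [h0] at hp
    simp only [polarPoint, Prod.mk.injEq] at hp
    have h1 : r * cos θ = 0 := by linarith [hp.1]
    have h2 : r * sin θ = 0 := by linarith [hp.2]
    have h3 : cos θ = 0 := by simpa [hr.ne'] using h1
    have h4 : sin θ = 0 := by simpa [hr.ne'] using h2
    have := sin_sq_add_cos_sq θ
    simp [h3, h4] at this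
  obtain ⟨ρ, θ, hρc, hρ, hpp, hθ⟩ := exists_polar_lift hγ hc
  have htube : ∀ t, |ρ t - R₀ (θ t)| < δ := fun t => by
    obtain ⟨r, φ, hr, hd, hp⟩ := hU ⟨t, rfl⟩
    rw [hpp t] at hp
    obtain ⟨rfl, n, hn⟩ := polarPoint_eq_iff (hρ t) hr hp
    rw [hn, (hR₀.int_mul n) φ]; exact hd
  have hθc : Continuous θ := continuous_iff_continuousAt.2 fun t => (hθ t).continuousAt
  set v : ℝ → ℝ := fun t => angularSpeed f g c ε (ρ t) (θ t) / ρ t with hv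
  have hwpos : ∀ t, 0 < angularSpeed f g c ε (ρ t) (θ t) := fun t => hw _ _ (htube t) (hρ t)
  have hvpos : ∀ t, 0 < v t := fun t => div_pos (hwpos t) (hρ t)
  have hvc : Continuous v := ((continuous_angularSpeed f g c).comp
    (continuous_const.prodMk (hρc.prodMk hθc))).div hρc fun t => (hρ t).ne'
  -- shifting time by a return time
  have hshift : ∀ s, (∀ t, γ (t + s) = γ t) → (∀ t, ρ (t + s) = ρ t) ∧ Function.Periodic v s ∧
      ∃ n : ℤ, ∀ t, θ (t + s) = θ t + n * (2 * π) := fun s hs => by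
    have hloc : ∀ t, ρ (t + s) = ρ t ∧ ∃ n : ℤ, θ (t + s) = θ t + n * (2 * π) := fun t =>
      polarPoint_eq_iff (hρ _) (hρ _) (by rw [← hpp, ← hpp, hs])
    have hvs : Function.Periodic v s := fun t => by
      obtain ⟨h1, n, hn⟩ := hloc t
      simp only [hv, h1, hn, angularSpeed, sin_add_int_mul_two_pi, cos_add_int_mul_two_pi]
    refine ⟨fun t => (hloc t).1, hvs, ?_⟩
    obtain ⟨n, hn⟩ := (hloc 0).2
    refine ⟨n, fun t => ?_⟩
    have hd : ∀ t, HasDerivAt (fun t => θ (t + s) - θ t) 0 t := fun t => by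
      have := ((hθ (t + s)).comp_add_const t s).fun_sub (hθ t)
      convert! this using 1
      have := hvs t
      simp only [hv] at this
      rw [this, sub_self]
    have := is_const_of_deriv_eq_zero (fun t => (hd t).differentiableAt)
      (fun t => (hd t).deriv) t 0
    linarith
  obtain ⟨hρT, hvT, n, hn⟩ := hshift T hγT
  obtain ⟨m, hm, hmv⟩ := IsPolarSolution.exists_lower_bound hvc hT hvT hvpos
  obtain ⟨σ, hσ1, hσ2, hσ3⟩ := exists_inverse_of_deriv_ge hθ hm hmv
  have hσc : Continuous σ := continuous_iff_continuousAt.2 fun t => (hσ3 t).continuousAt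
  have hmono : StrictMono θ := strictMono_of_deriv_pos fun s => by
    rw [(hθ s).deriv]; exact hvpos s
  have hnpos : 0 < n := by
    have h1 := hmono (show (0 : ℝ) < 0 + T by linarith)
    rw [hn 0] at h1
    have : (0 : ℝ) < n := by
      by_contra! hle
      nlinarith [two_pi_pos]
    exact_mod_cast this
  obtain ⟨k, rfl⟩ := Int.eq_ofNat_of_zero_le hnpos.le
  have hk : k ≠ 0 := by rintro rfl; simp at hnpos
  set R : ℝ → ℝ := fun φ => ρ (σ φ) with hR
  have hRc : Continuous R := hρc.comp hσc
  have hRp : ∀ φ, polarPoint c (R φ) φ = γ (σ φ) := fun φ => by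
    rw [hpp, hσ1]
  have hRT : Function.Periodic R (k * (2 * π)) := fun φ => by
    have : σ (φ + k * (2 * π)) = σ φ + T := by
      rw [← hσ2 (σ φ + T), hn, hσ1]; simp
    simp only [hR, this, hρT]
  obtain ⟨φ, hφ⟩ := exists_eq_add_of_periodic hRc hk hRT
  have hper : Function.Periodic R (2 * π) := by
    set s := σ (φ + 2 * π) - σ φ with hs
    have hbd : Bornology.IsBounded (range γ) := by
      have hγc : Continuous γ := continuous_iff_continuousAt.2 fun t => (hγ t).continuousAt
      exact hγT.isBounded_of_continuous hT.ne' hγc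
    have hγs : (fun t => γ (t + s)) = γ := by
      refine lienard_solution_unique (fun t => (hγ (t + s)).comp_add_const t s) hγ hbd
        (fun t => ⟨_, rfl⟩) (fun t => ⟨_, rfl⟩) (t₀ := σ φ) ?_
      have : σ φ + s = σ (φ + 2 * π) := by rw [hs]; ring
      rw [this, ← hRp, ← hRp, hφ]
      simpa using polarPoint_add_int c (R φ) φ 1
    obtain ⟨h1, -, j, hj⟩ := hshift s fun t => congrFun hγs t
    have hj1 : (j : ℝ) * (2 * π) = 2 * π := by
      have := hj (σ φ)
      rw [show σ φ + s = σ (φ + 2 * π) by rw [hs]; ring, hσ1, hσ1] at this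
      linarith
    intro x
    have : σ (x + 2 * π) = σ x + s := by
      rw [← hσ2 (σ x + s), hj, hσ1, hj1]
    simp only [hR, this, h1]
  have hRtube : ∀ θ', |R θ' - R₀ θ'| < δ := fun θ' => by
    have := htube (σ θ'); rwa [hσ1] at this
  have hRw : ∀ θ', 0 < angularSpeed f g c ε (R θ') θ' := fun θ' => hw _ _ (hRtube θ') (hρ _)
  refine ⟨polarEnergy G c (R 0) 0, R, ⟨hRc, fun θ' => hρ _, hRw,
    fun θ' => hr _ _ (hRtube θ') (hρ _), fun θ' => ?_⟩, hper, hRtube, ?_⟩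
  · have hd : ∀ φ, HasDerivAt (fun φ => polarEnergy G c (R φ) φ)
        (-ε * energyLoss f g c ε (R φ) φ) φ := fun φ => by
      have h0 : (fun φ => polarEnergy G c (R φ) φ) =
          fun φ => (γ (σ φ)).2 ^ 2 / 2 + G.eval (γ (σ φ)).1 := by
        ext φ
        rw [← hRp]; simp only [polarEnergy, polarPoint]; ring
      rw [h0]
      have hx := (hasDerivAt_comp_fst (hγ (σ φ))).comp φ (hσ3 φ)
      have hy := (hasDerivAt_comp_snd (hγ (σ φ))).comp φ (hσ3 φ)
      have := ((hy.pow 2).div_const 2).add ((G.hasDerivAt _).comp φ hx)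
      convert! this using 1
      simp only [Function.comp, hσ1, hG]
      rw [← hRp]
      simp only [lienard, polarPoint, energyLoss]
      rw [show ρ (σ φ) = R φ from rfl]
      have h1 := (hRw φ).ne'
      have h2 := (hρ (σ φ)).ne'
      rw [show ρ (σ φ) = R φ from rfl] at h2
      field_simp
      ring
    have hlc : Continuous fun φ => energyLoss f g c ε (R φ) φ := by
      unfold energyLoss
      exact Continuous.div (by fun_prop) ((continuous_angularSpeed f g c).comp
        (continuous_const.prodMk (hRc.prodMk continuous_id))) fun φ => (hRw φ).ne'
    have := intervalIntegral.integral_eq_sub_of_hasDerivAt (a := 0) (b := θ')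
      (fun x _ => hd x) ((hlc.const_mul _).intervalIntegrable _ _)
    rw [intervalIntegral.integral_const_mul] at this
    linarith
  · ext p; constructor
    · rintro ⟨t, rfl⟩; exact ⟨θ t, by simp only [hRp, hσ2]⟩
    · rintro ⟨φ, rfl⟩; exact ⟨σ φ, (hRp φ).symm⟩

/-! ### The energy equation in a Banach algebra of continuous functions -/

/-- One turn of the angle. -/
abbrev Turn : Type := Icc (0 : ℝ) (2 * π)

lemma contDiff_aeval_algebra {𝔸 : Type*} [NormedCommRing 𝔸] [NormedAlgebra ℝ 𝔸] (p : ℝ[X])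
    {n : WithTop ℕ∞} : ContDiff ℝ n fun u : 𝔸 => aeval u p := by
  induction p using Polynomial.induction_on' with
  | add p q hp hq => simpa using hp.add hq
  | monomial k a => simpa [aeval_monomial] using contDiff_const.mul (contDiff_id.pow k)

lemma hasFDerivAt_aeval_algebra {𝔸 : Type*} [NormedCommRing 𝔸] [NormedAlgebra ℝ 𝔸] (p : ℝ[X])
    (u : 𝔸) : HasFDerivAt (fun u : 𝔸 => aeval u p)
      (ContinuousLinearMap.mul ℝ 𝔸 (aeval u (derivative p))) u := by
  induction p using Polynomial.induction_on with
  | C a => simpa using hasFDerivAt_const (algebraMap ℝ 𝔸 a) u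
  | add p q hp hq => simpa using hp.fun_add hq
  | monomial k a ih =>
    have := ih.mul (hasFDerivAt_id u)
    simp only [pow_succ, ← mul_assoc] at this ⊢
    convert! this using 1
    · ext v; simp
    · ext v; simp [mul_assoc]; ring

lemma isInvertible_mul_of_isUnit {𝔸 : Type*} [NormedCommRing 𝔸] [NormedAlgebra ℝ 𝔸] {a : 𝔸}
    (ha : IsUnit a) : (ContinuousLinearMap.mul ℝ 𝔸 a).IsInvertible := by
  obtain ⟨u, rfl⟩ := ha
  exact ⟨ContinuousLinearEquiv.equivOfInverse (ContinuousLinearMap.mul ℝ 𝔸 u)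
    (ContinuousLinearMap.mul ℝ 𝔸 ↑u⁻¹) (fun x => by simp) (fun x => by simp), by ext; simp⟩

/-- `cos` on one turn. -/
noncomputable def cosTurn : C(Turn, ℝ) := ⟨fun θ => cos θ, by fun_prop⟩

/-- `sin` on one turn. -/
noncomputable def sinTurn : C(Turn, ℝ) := ⟨fun θ => sin θ, by fun_prop⟩

/-- Continuous extension to the line of a function on one turn. -/
noncomputable def turnExtend (z : C(Turn, ℝ)) : ℝ → ℝ := IccExtend two_pi_pos.le z

lemma continuous_turnExtend (z : C(Turn, ℝ)) : Continuous (turnExtend z) :=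
  z.continuous.Icc_extend'

lemma turnExtend_coe (z : C(Turn, ℝ)) (θ : Turn) : turnExtend z θ = z θ :=
  IccExtend_val _ _ _

lemma turnExtend_of_mem (z : C(Turn, ℝ)) {θ : ℝ} (h : θ ∈ Icc (0 : ℝ) (2 * π)) :
    turnExtend z θ = z ⟨θ, h⟩ :=
  IccExtend_of_mem _ _ h

/-- The primitive vanishing at `0`, as a continuous linear operator. -/
noncomputable def turnIntegral : C(Turn, ℝ) →L[ℝ] C(Turn, ℝ) :=
  LinearMap.mkContinuous
    { toFun := fun z => ⟨fun θ => ∫ s in (0 : ℝ)..θ, turnExtend z s,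
        (intervalIntegral.continuous_primitive
          (fun a b => (continuous_turnExtend z).intervalIntegrable a b) 0).comp
          continuous_subtype_val⟩
      map_add' := fun z w => by
        ext θ
        exact intervalIntegral.integral_add ((continuous_turnExtend z).intervalIntegrable _ _)
          ((continuous_turnExtend w).intervalIntegrable _ _)
      map_smul' := fun a z => by
        ext θ
        exact intervalIntegral.integral_const_mul _ _ }
    (2 * π) fun z => by
      refine (ContinuousMap.norm_le _ (by positivity)).2 fun θ => ?_
      have h1 : ‖∫ s in (0 : ℝ)..θ, turnExtend z s‖ ≤ ‖z‖ * |(θ : ℝ) - 0| :=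
        intervalIntegral.norm_integral_le_of_norm_le_const fun s _ => z.norm_coe_le_norm _
      have h2 : |(θ : ℝ) - 0| ≤ 2 * π := by
        rw [sub_zero, abs_of_nonneg θ.2.1]; exact θ.2.2
      calc _ ≤ ‖z‖ * |(θ : ℝ) - 0| := h1
        _ ≤ ‖z‖ * (2 * π) := by gcongr
        _ = 2 * π * ‖z‖ := mul_comm _ _

lemma turnIntegral_apply (z : C(Turn, ℝ)) (θ : Turn) :
    turnIntegral z θ = ∫ s in (0 : ℝ)..θ, turnExtend z s := rfl

/-- The abscissa along a path given in polar coordinates. -/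
noncomputable def turnX (c : ℝ) (z : C(Turn, ℝ)) : C(Turn, ℝ) :=
  algebraMap ℝ _ c + z * cosTurn

/-- `polarEnergy` along a path. -/
noncomputable def turnEnergy (G : ℝ[X]) (c : ℝ) (z : C(Turn, ℝ)) : C(Turn, ℝ) :=
  (1 / 2 : ℝ) • (z ^ 2 * sinTurn ^ 2) + aeval (turnX c z) G

/-- `angularSpeed` along a path. -/
noncomputable def turnSpeed (f g : ℝ[X]) (c ε : ℝ) (z : C(Turn, ℝ)) : C(Turn, ℝ) :=
  z * sinTurn ^ 2 + cosTurn * (aeval (turnX c z) g - ε • (aeval (turnX c z) f * (z * sinTurn)))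

/-- `energyLoss` along a path. -/
noncomputable def turnLoss (f g : ℝ[X]) (c ε : ℝ) (z : C(Turn, ℝ)) : C(Turn, ℝ) :=
  aeval (turnX c z) f * z ^ 3 * sinTurn ^ 2 * Ring.inverse (turnSpeed f g c ε z)

lemma turnX_apply (c : ℝ) (z : C(Turn, ℝ)) (θ : Turn) : turnX c z θ = c + z θ * cos θ := by
  simp [turnX, cosTurn]

lemma turnEnergy_apply (G : ℝ[X]) (c : ℝ) (z : C(Turn, ℝ)) (θ : Turn) :
    turnEnergy G c z θ = polarEnergy G c (z θ) θ := by
  simp [turnEnergy, polarEnergy, turnX_apply, sinTurn]; ring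

lemma turnSpeed_apply (f g : ℝ[X]) (c ε : ℝ) (z : C(Turn, ℝ)) (θ : Turn) :
    turnSpeed f g c ε z θ = angularSpeed f g c ε (z θ) θ := by
  simp [turnSpeed, angularSpeed, turnX_apply, sinTurn, cosTurn]

lemma isUnit_turnSpeed {f g : ℝ[X]} {c ε : ℝ} {z : C(Turn, ℝ)}
    (h : ∀ θ : Turn, 0 < angularSpeed f g c ε (z θ) θ) : IsUnit (turnSpeed f g c ε z) :=
  (ContinuousMap.isUnit_iff_forall_ne_zero _).2 fun θ => by
    rw [turnSpeed_apply]; exact (h θ).ne'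

lemma turnLoss_apply {f g : ℝ[X]} {c ε : ℝ} {z : C(Turn, ℝ)}
    (h : ∀ θ : Turn, 0 < angularSpeed f g c ε (z θ) θ) (θ : Turn) :
    turnLoss f g c ε z θ = energyLoss f g c ε (z θ) θ := by
  have hu := Ring.mul_inverse_cancel _ (isUnit_turnSpeed h)
  have h1 := DFunLike.congr_fun hu θ
  simp only [ContinuousMap.mul_apply, ContinuousMap.one_apply, turnSpeed_apply] at h1
  have h2 : Ring.inverse (turnSpeed f g c ε z) θ = (angularSpeed f g c ε (z θ) θ)⁻¹ :=
    eq_inv_of_mul_eq_one_right h1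
  simp [turnLoss, energyLoss, h2, turnX_apply, sinTurn, div_eq_mul_inv]

lemma contDiff_turnX (c : ℝ) {n : WithTop ℕ∞} : ContDiff ℝ n (turnX c) := by
  unfold turnX; fun_prop

lemma contDiff_turnSpeed (f g : ℝ[X]) (c : ℝ) {n : WithTop ℕ∞} :
    ContDiff ℝ n fun p : ℝ × C(Turn, ℝ) => turnSpeed f g c p.1 p.2 := by
  have hX : ContDiff ℝ n fun p : ℝ × C(Turn, ℝ) => turnX c p.2 :=
    (contDiff_turnX c).comp contDiff_snd
  have hf := (contDiff_aeval_algebra f (n := n)).comp hX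
  have hg := (contDiff_aeval_algebra g (n := n)).comp hX
  simp only [Function.comp_def] at hf hg
  unfold turnSpeed
  fun_prop

lemma contDiffAt_turnLoss {f g : ℝ[X]} {c ε : ℝ} {z : C(Turn, ℝ)} {n : WithTop ℕ∞}
    (h : ∀ θ : Turn, 0 < angularSpeed f g c ε (z θ) θ) :
    ContDiffAt ℝ n (fun p : ℝ × C(Turn, ℝ) => turnLoss f g c p.1 p.2) (ε, z) := by
  have hX : ContDiff ℝ n fun p : ℝ × C(Turn, ℝ) => turnX c p.2 :=
    (contDiff_turnX c).comp contDiff_snd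
  have hf := (contDiff_aeval_algebra f (n := n)).comp hX
  simp only [Function.comp_def] at hf
  obtain ⟨u, hu⟩ := isUnit_turnSpeed h
  have hi : ContDiffAt ℝ n (fun p : ℝ × C(Turn, ℝ) => Ring.inverse (turnSpeed f g c p.1 p.2))
      (ε, z) := by
    have h0 := contDiffAt_ringInverse ℝ (n := n) u
    rw [hu] at h0
    exact ContDiffAt.comp (ε, z) h0 (contDiff_turnSpeed f g c).contDiffAt
  have h3 : ContDiffAt ℝ n (fun p : ℝ × C(Turn, ℝ) => aeval (turnX c p.2) f * p.2 ^ 3 *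
      sinTurn ^ 2) (ε, z) := by
    have : ContDiff ℝ n (fun p : ℝ × C(Turn, ℝ) => aeval (turnX c p.2) f * p.2 ^ 3 *
      sinTurn ^ 2) := by fun_prop
    exact this.contDiffAt
  exact h3.mul hi

lemma contDiff_turnEnergy (G : ℝ[X]) (c : ℝ) {n : WithTop ℕ∞} :
    ContDiff ℝ n (turnEnergy G c) := by
  have hG := (contDiff_aeval_algebra G (n := n)).comp (contDiff_turnX c)
  simp only [Function.comp_def] at hG
  unfold turnEnergy
  fun_prop

lemma hasFDerivAt_turnEnergy {g G : ℝ[X]} (hG : derivative G = g) (c : ℝ) (z : C(Turn, ℝ)) :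
    HasFDerivAt (turnEnergy G c) (ContinuousLinearMap.mul ℝ C(Turn, ℝ)
      (z * sinTurn ^ 2 + cosTurn * aeval (turnX c z) g)) z := by
  have hX : HasFDerivAt (turnX c) (ContinuousLinearMap.mul ℝ C(Turn, ℝ) cosTurn) z := by
    have := ((hasFDerivAt_id (𝕜 := ℝ) z).mul_const cosTurn).const_add (algebraMap ℝ C(Turn, ℝ) c)
    convert! this using 1
  have h1 := (hasFDerivAt_aeval_algebra G (turnX c z)).comp z hX
  have h2 := ((((hasFDerivAt_id (𝕜 := ℝ) z).pow 2).mul_const (sinTurn ^ 2)).const_smul (1 / 2 : ℝ)).add h1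
  convert! h2 using 1
  ext v θ
  have h3 : (2 : C(Turn, ℝ)) θ = 2 := rfl
  simp [hG, h3]
  ring

/-! ### A chart of nearby solutions -/

/-- The regularity conditions at a point `(r, θ)` close to an unperturbed oval. -/
structure IsRegularAt (f g : ℝ[X]) (c : ℝ) (O : Set (ℝ × ℝ)) (ε r θ : ℝ) : Prop where
  pos : 0 < r
  radial_pos : 0 < radialDeriv g c r θ
  speed_pos : 0 < angularSpeed f g c ε r θ
  mem : polarPoint c r θ ∈ O

lemma exists_mem_Ico_add_int (θ : ℝ) : ∃ n : ℤ, θ + n * (2 * π) ∈ Ico (0 : ℝ) (2 * π) := by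
  obtain ⟨n, hn, -⟩ := existsUnique_add_zsmul_mem_Ico two_pi_pos θ 0
  exact ⟨n, by simpa using hn⟩

lemma isRegularAt_add_int {f g : ℝ[X]} {c : ℝ} {O : Set (ℝ × ℝ)} {ε r θ : ℝ} (n : ℤ) :
    IsRegularAt f g c O ε r (θ + n * (2 * π)) ↔ IsRegularAt f g c O ε r θ := by
  have h1 : radialDeriv g c r (θ + n * (2 * π)) = radialDeriv g c r θ := by simp [radialDeriv]
  have h2 : angularSpeed f g c ε r (θ + n * (2 * π)) = angularSpeed f g c ε r θ := by
    simp [angularSpeed]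
  have h3 := polarPoint_add_int c r θ n
  constructor <;> rintro ⟨e1, e2, e3, e4⟩
  · exact ⟨e1, h1 ▸ e2, h2 ▸ e3, h3 ▸ e4⟩
  · exact ⟨e1, h1.symm ▸ e2, h2.symm ▸ e3, h3.symm ▸ e4⟩

lemma exists_tube {f g : ℝ[X]} {c : ℝ} {O : Set (ℝ × ℝ)} (hO : IsOpen O) {R₀ : ℝ → ℝ}
    (hc : Continuous R₀) (hp : Function.Periodic R₀ (2 * π))
    (h₀ : ∀ θ, IsRegularAt f g c O 0 (R₀ θ) θ) :
    ∃ δ, 0 < δ ∧ ∀ ε r θ, |ε| < δ → |r - R₀ θ| < δ → IsRegularAt f g c O ε r θ := by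
  set T : Set (ℝ × ℝ × ℝ) := {p | IsRegularAt f g c O p.1 p.2.1 p.2.2} with hT
  have hTo : IsOpen T := by
    have : T = {p | 0 < p.2.1} ∩ {p | 0 < radialDeriv g c p.2.1 p.2.2} ∩
        {p | 0 < angularSpeed f g c p.1 p.2.1 p.2.2} ∩
        (fun p : ℝ × ℝ × ℝ => polarPoint c p.2.1 p.2.2) ⁻¹' O := by
      ext p
      exact ⟨fun h => ⟨⟨⟨h.1, h.2⟩, h.3⟩, h.4⟩, fun h => ⟨h.1.1.1, h.1.1.2, h.1.2, h.2⟩⟩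
    rw [this]
    refine ((IsOpen.inter (isOpen_lt (by fun_prop) (by fun_prop)) (isOpen_lt (by fun_prop) ?_)).inter
      (isOpen_lt (by fun_prop) (continuous_angularSpeed f g c))).inter (hO.preimage ?_)
    · exact (continuous_radialDeriv g c).comp continuous_snd
    · unfold polarPoint; fun_prop
  have hK : IsCompact ((fun θ => ((0 : ℝ), R₀ θ, θ)) '' Icc 0 (2 * π)) :=
    isCompact_Icc.image (by fun_prop)
  obtain ⟨δ, hδ, hsub⟩ := hK.exists_thickening_subset_open hTo (by
    rintro - ⟨θ, -, rfl⟩; exact h₀ θ)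
  refine ⟨δ, hδ, fun ε r θ hε hr => ?_⟩
  obtain ⟨n, hn⟩ := exists_mem_Ico_add_int θ
  rw [← isRegularAt_add_int n]
  refine hsub (a := (ε, r, θ + n * (2 * π)))
    (Metric.mem_thickening_iff.2 ⟨_, ⟨_, Ico_subset_Icc_self hn, rfl⟩, ?_⟩)
  have : R₀ (θ + n * (2 * π)) = R₀ θ := hp.int_mul n θ
  simp [Prod.dist_eq, Real.dist_eq, this, hε, hr]

lemma hasDerivAt_polarEnergy {g G : ℝ[X]} (hG : derivative G = g) (c r θ : ℝ) :
    HasDerivAt (fun r => polarEnergy G c r θ) (radialDeriv g c r θ) r := by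
  have h1 := (((hasDerivAt_id r).pow 2).mul_const (sin θ ^ 2)).div_const 2
  have h2 := (G.hasDerivAt (c + r * cos θ)).comp r
    (((hasDerivAt_id r).mul_const (cos θ)).const_add c)
  have := h1.add h2
  convert! this using 1
  simp [radialDeriv, hG]; ring

lemma polarEnergy_injOn {g G : ℝ[X]} (hG : derivative G = g) {c θ a b : ℝ}
    (h : ∀ r ∈ Ioo a b, 0 < radialDeriv g c r θ) :
    InjOn (fun r => polarEnergy G c r θ) (Ioo a b) := by
  refine (strictMonoOn_of_deriv_pos (convex_Ioo a b) (fun r _ =>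
    (hasDerivAt_polarEnergy hG c r θ).continuousAt.continuousWithinAt) fun r hr => ?_).injOn
  rw [(hasDerivAt_polarEnergy hG c r θ).deriv]
  exact h r (interior_subset hr)

lemma exists_periodic_extension {z : ℝ → ℝ} (hz : Continuous z) (h0 : z 0 = z (2 * π)) :
    ∃ R : ℝ → ℝ, Continuous R ∧ Function.Periodic R (2 * π) ∧
      ∀ θ ∈ Icc (0 : ℝ) (2 * π), R θ = z θ := by
  have : Fact (0 < 2 * π) := ⟨two_pi_pos⟩
  have hc : Continuous (AddCircle.liftIco (2 * π) 0 z) :=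
    AddCircle.liftIco_continuous (by simpa using h0) hz.continuousOn
  have hper : Function.Periodic (fun θ : ℝ => AddCircle.liftIco (2 * π) 0 z θ) (2 * π) :=
    fun θ => by simp
  have hIco : ∀ θ ∈ Ico (0 : ℝ) (2 * π), AddCircle.liftIco (2 * π) 0 z θ = z θ := fun θ hθ =>
    AddCircle.liftIco_coe_apply (by simpa using hθ)
  refine ⟨_, hc.comp (AddCircle.continuous_mk' _), hper, fun θ hθ => ?_⟩
  rcases hθ.2.lt_or_eq with h | h
  · exact hIco θ ⟨hθ.1, h⟩
  · have := hper 0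
    simp only [zero_add] at this
    rw [h, ← h0]
    exact this.trans (hIco 0 ⟨le_rfl, two_pi_pos⟩)

lemma turnIntegral_turnLoss {f g : ℝ[X]} {c ε : ℝ} {z : C(Turn, ℝ)} {R : ℝ → ℝ}
    (hR : ∀ θ : Turn, R θ = z θ) (hw : ∀ θ : Turn, 0 < angularSpeed f g c ε (z θ) θ) (θ : Turn) :
    turnIntegral (turnLoss f g c ε z) θ = ∫ s in (0 : ℝ)..θ, energyLoss f g c ε (R s) s := by
  rw [turnIntegral_apply]
  refine intervalIntegral.integral_congr fun s hs => ?_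
  rw [uIcc_of_le θ.2.1] at hs
  have hs' : s ∈ Icc (0 : ℝ) (2 * π) := ⟨hs.1, hs.2.trans θ.2.2⟩
  rw [turnExtend_of_mem _ hs', turnLoss_apply hw, ← hR]

lemma exists_isPolarSolution_of_turn {f g G : ℝ[X]} {c ε h : ℝ} {O : Set (ℝ × ℝ)}
    {z : C(Turn, ℝ)} (hreg : ∀ θ : Turn, IsRegularAt f g c O ε (z θ) θ)
    (h0 : z ⟨0, left_mem_Icc.2 two_pi_pos.le⟩ = z ⟨2 * π, right_mem_Icc.2 two_pi_pos.le⟩)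
    (hE : turnEnergy G c z = algebraMap ℝ _ h - ε • turnIntegral (turnLoss f g c ε z))
    (hI : turnIntegral (turnLoss f g c ε z) ⟨2 * π, right_mem_Icc.2 two_pi_pos.le⟩ = 0) :
    ∃ R, IsPolarSolution f g G c ε h R ∧ Function.Periodic R (2 * π) ∧
      (∀ θ, IsRegularAt f g c O ε (R θ) θ) ∧ ∀ θ : Turn, R θ = z θ := by
  obtain ⟨R, hRc, hRp, hR⟩ := exists_periodic_extension (continuous_turnExtend z) (by
    rw [turnExtend_of_mem z (left_mem_Icc.2 two_pi_pos.le), h0,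
      turnExtend_of_mem z (right_mem_Icc.2 two_pi_pos.le)])
  have hRz : ∀ θ : Turn, R θ = z θ := fun θ => by rw [hR θ θ.2, turnExtend_coe]
  have hRn : ∀ (n : ℤ) θ, R (θ + n * (2 * π)) = R θ := fun n θ => hRp.int_mul n θ
  have hregR : ∀ θ, IsRegularAt f g c O ε (R θ) θ := fun θ => by
    obtain ⟨n, hn⟩ := exists_mem_Ico_add_int θ
    rw [← isRegularAt_add_int n, ← hRn n θ]
    have := hreg ⟨_, Ico_subset_Icc_self hn⟩
    rwa [← hRz] at this
  have hlc : Continuous fun φ => energyLoss f g c ε (R φ) φ := by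
    unfold energyLoss
    exact Continuous.div (by fun_prop) ((continuous_angularSpeed f g c).comp
      (continuous_const.prodMk (hRc.prodMk continuous_id))) fun φ => (hregR φ).speed_pos.ne'
  have hlp : Function.Periodic (fun φ => energyLoss f g c ε (R φ) φ) (2 * π) := fun φ => by
    simp only [energyLoss, hRp φ, angularSpeed, cos_add_two_pi, sin_add_two_pi]
  have hint : ∀ θ : Turn, turnIntegral (turnLoss f g c ε z) θ =
      ∫ s in (0 : ℝ)..θ, energyLoss f g c ε (R s) s :=
    turnIntegral_turnLoss hRz fun θ => (hreg θ).speed_pos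
  have hzero : ∫ s in (0 : ℝ)..(2 * π), energyLoss f g c ε (R s) s = 0 :=
    (hint ⟨2 * π, right_mem_Icc.2 two_pi_pos.le⟩).symm.trans hI
  have hEz : ∀ θ : Turn, polarEnergy G c (R θ) θ =
      h - ε * ∫ s in (0 : ℝ)..θ, energyLoss f g c ε (R s) s := fun θ => by
    have := DFunLike.congr_fun hE θ
    rw [turnEnergy_apply] at this
    rw [hRz, this, ← hint]; simp
  refine ⟨R, ⟨hRc, fun θ => (hregR θ).pos, fun θ => (hregR θ).speed_pos,
    fun θ => (hregR θ).radial_pos, fun θ => ?_⟩, hRp, hregR, hRz⟩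
  obtain ⟨n, hn⟩ := exists_mem_Ico_add_int θ
  have h1 := hEz ⟨_, Ico_subset_Icc_self hn⟩
  have h2 : ∫ s in (0 : ℝ)..(θ + n * (2 * π)), energyLoss f g c ε (R s) s =
      ∫ s in (0 : ℝ)..θ, energyLoss f g c ε (R s) s := by
    have := hlp.intervalIntegral_add_zsmul_eq n θ (fun a b => hlc.intervalIntegrable a b)
    rw [zsmul_eq_mul, zsmul_eq_mul, hlp.intervalIntegral_add_eq θ 0, zero_add, hzero,
      mul_zero] at this
    rw [← intervalIntegral.integral_add_adjacent_intervals (hlc.intervalIntegrable 0 θ)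
      (hlc.intervalIntegrable _ _), this, add_zero]
  simp only [hRn, h2] at h1
  rw [← h1]; simp [polarEnergy]

open scoped ContDiff in
/-- Near an unperturbed oval the perturbed solutions are parametrized analytically by the
initial energy and `ε`; simple isolated zeros of the energy loss over one turn give limit
cycles. -/
lemma exists_chart {f g G : ℝ[X]} (hG : derivative G = g) {c hs : ℝ} {O : Set (ℝ × ℝ)}
    (hO : IsOpen O) {R₀ : ℝ → ℝ} (h₀ : IsPolarSolution f g G c 0 hs R₀)
    (hp : Function.Periodic R₀ (2 * π)) (hmem : ∀ θ, polarPoint c (R₀ θ) θ ∈ O) :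
    ∃ η, 0 < η ∧ ∃ D : ℝ × ℝ → ℝ,
      (∀ h ε, |h - hs| < η → |ε| < η → ContDiffAt ℝ ω D (h, ε)) ∧
      (∀ h, |h - hs| < η → ∃ z : C(Turn, ℝ), (∀ θ : Turn, IsRegularAt f g c O 0 (z θ) θ ∧
        polarEnergy G c (z θ) θ = h) ∧
        D (h, 0) = ∫ s in (0 : ℝ)..(2 * π), energyLoss f g c 0 (turnExtend z s) s) ∧
      ∀ h ε, |h - hs| < η → 0 < ε → ε < η → D (h, ε) = 0 → (∀ᶠ h' in 𝓝[≠] h, D (h', ε) ≠ 0) →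
        ∃ Γ, IsLimitCycle (lienard f g ε) Γ ∧ Γ ⊆ O := by
  obtain ⟨δ, hδ, htube⟩ := exists_tube (f := f) (g := g) (c := c) hO h₀.continuous hp fun θ =>
    ⟨h₀.pos θ, h₀.radial_pos θ, h₀.speed_pos θ, hmem θ⟩
  set z₀ : C(Turn, ℝ) := ⟨fun θ => R₀ θ, h₀.continuous.comp continuous_subtype_val⟩ with hz₀
  set Φ : (ℝ × ℝ) × C(Turn, ℝ) → C(Turn, ℝ) := fun p => turnEnergy G c p.2 -
    algebraMap ℝ C(Turn, ℝ) p.1.1 + p.1.2 • turnIntegral (turnLoss f g c p.1.2 p.2) with hΦ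
  have hclose : ∀ {z : C(Turn, ℝ)} {d : ℝ}, ‖z - z₀‖ < d → ∀ θ : Turn, |z θ - R₀ θ| < d :=
    fun {z d} hz θ => ((z - z₀).norm_coe_le_norm θ).trans_lt hz
  have hspeed : ∀ {ε : ℝ} {z : C(Turn, ℝ)}, |ε| < δ → ‖z - z₀‖ < δ →
      ∀ θ : Turn, 0 < angularSpeed f g c ε (z θ) θ := fun hε hz θ =>
    (htube _ _ _ hε (hclose hz θ)).speed_pos
  have hloss : ∀ {ε : ℝ} {z : C(Turn, ℝ)}, |ε| < δ → ‖z - z₀‖ < δ →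
      ContDiffAt ℝ ω (fun p : ℝ × C(Turn, ℝ) => turnLoss f g c p.1 p.2) (ε, z) := fun hε hz =>
    contDiffAt_turnLoss (hspeed hε hz)
  set u₀ : (ℝ × ℝ) × C(Turn, ℝ) := ((hs, 0), z₀) with hu₀
  have hz₀0 : ‖z₀ - z₀‖ < δ := by simpa using hδ
  have hΦc : ContDiffAt ℝ ω Φ u₀ := by
    have h1 : ContDiffAt ℝ ω (fun p : (ℝ × ℝ) × C(Turn, ℝ) => turnEnergy G c p.2) u₀ :=
      ((contDiff_turnEnergy G c).comp contDiff_snd).contDiffAt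
    have h2 : ContDiffAt ℝ ω (fun p : (ℝ × ℝ) × C(Turn, ℝ) =>
        algebraMap ℝ C(Turn, ℝ) p.1.1) u₀ :=
      ((algebraMapCLM ℝ C(Turn, ℝ)).contDiff.comp (contDiff_fst.comp contDiff_fst)).contDiffAt
    have h3 : ContDiffAt ℝ ω (fun p : (ℝ × ℝ) × C(Turn, ℝ) =>
        turnLoss f g c p.1.2 p.2) u₀ :=
      ContDiffAt.comp u₀ (hloss (ε := 0) (z := z₀) (by simpa using hδ) hz₀0)
        (f := fun p : (ℝ × ℝ) × C(Turn, ℝ) => (p.1.2, p.2)) (by fun_prop)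
    have h4 := (turnIntegral.contDiff (n := ω)).contDiffAt.comp u₀ h3
    exact (h1.sub h2).add (ContDiffAt.smul (contDiff_snd.comp contDiff_fst).contDiffAt h4)
  have hΦ0 : Φ u₀ = 0 := by
    ext θ
    have := h₀.energy θ
    simp only [zero_mul, sub_zero] at this
    simp [hΦ, hu₀, turnEnergy_apply, hz₀, this]
  have hinv : (fderiv ℝ Φ u₀ ∘L .inr ℝ (ℝ × ℝ) C(Turn, ℝ)).IsInvertible := by
    have hu : IsUnit (z₀ * sinTurn ^ 2 + cosTurn * aeval (turnX c z₀) g) := by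
      refine (ContinuousMap.isUnit_iff_forall_ne_zero _).2 fun θ => ?_
      have := (h₀.radial_pos θ).ne'
      simpa [radialDeriv, hz₀, sinTurn, cosTurn, turnX_apply] using this
    have h1 : HasFDerivAt (fun z => Φ ((hs, 0), z))
        (fderiv ℝ Φ u₀ ∘L .inr ℝ (ℝ × ℝ) C(Turn, ℝ)) z₀ :=
      HasFDerivAt.comp z₀ ((hΦc.differentiableAt (by simp)).hasFDerivAt)
        (hasFDerivAt_prodMk_right (hs, (0 : ℝ)) z₀)
    have h2 : (fun z => Φ ((hs, 0), z)) = fun z => turnEnergy G c z - algebraMap ℝ _ hs := by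
      ext z; simp [hΦ]
    rw [h2] at h1
    rw [h1.unique ((hasFDerivAt_turnEnergy hG c z₀).sub_const _)]
    exact isInvertible_mul_of_isUnit hu
  set ψ := hΦc.implicitFunction (by simp) hinv with hψ
  have hψ0 : ψ (hs, 0) = z₀ := hΦc.implicitFunction_apply_self (by simp) hinv
  have hψc : ContDiffAt ℝ ω ψ (hs, 0) := hΦc.contDiffAt_implicitFunction (by simp) hinv
  obtain ⟨δ₁, hδ₁, hiff⟩ := Metric.eventually_nhds_iff.1
    (hΦc.eventually_apply_eq_iff_implicitFunction (by simp) hinv)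
  have hev : ∀ᶠ p in 𝓝 ((hs, 0) : ℝ × ℝ), ‖ψ p - z₀‖ < min δ δ₁ ∧ ContDiffAt ℝ ω ψ p ∧
      Φ (p, ψ p) = 0 ∧ dist p (hs, 0) < min δ δ₁ := by
    have e1 : ∀ᶠ p in 𝓝 ((hs, 0) : ℝ × ℝ), ‖ψ p - z₀‖ < min δ δ₁ := by
      have : Tendsto ψ (𝓝 (hs, 0)) (𝓝 z₀) := hψ0 ▸ hψc.continuousAt.tendsto
      simpa [dist_eq_norm] using this.eventually (Metric.ball_mem_nhds z₀ (lt_min hδ hδ₁))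
    have e3 := hΦc.eventually_apply_implicitFunction (by simp) hinv
    rw [hΦ0] at e3
    exact e1.and ((hψc.eventually (by simp)).and (e3.and
      (Metric.ball_mem_nhds _ (lt_min hδ hδ₁))))
  obtain ⟨η, hη, hev⟩ := Metric.eventually_nhds_iff.1 hev
  have hev' : ∀ h ε, |h - hs| < η → |ε| < η → ‖ψ (h, ε) - z₀‖ < min δ δ₁ ∧
      ContDiffAt ℝ ω ψ (h, ε) ∧ Φ ((h, ε), ψ (h, ε)) = 0 ∧ |h - hs| < min δ δ₁ ∧
      |ε| < min δ δ₁ := fun h ε hh hε => by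
    obtain ⟨e1, e2, e3, e4⟩ := hev (y := (h, ε)) (by simpa [Prod.dist_eq, Real.dist_eq] using ⟨hh, hε⟩)
    rw [Prod.dist_eq, max_lt_iff] at e4
    exact ⟨e1, e2, e3, by simpa [Real.dist_eq] using e4.1, by simpa [Real.dist_eq] using e4.2⟩
  have huniq : ∀ {h ε : ℝ} {z : C(Turn, ℝ)}, |h - hs| < η → |ε| < η → ‖z - z₀‖ < min δ δ₁ →
      Φ ((h, ε), z) = 0 → ψ (h, ε) = z := fun {h ε z} hh hε hz hz0 => by
    obtain ⟨-, -, -, e4, e5⟩ := hev' h ε hh hε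
    refine (hiff (y := ((h, ε), z)) ?_).1 (hz0.trans hΦ0.symm)
    rw [Prod.dist_eq, Prod.dist_eq]
    simp only [max_lt_iff, Real.dist_eq, hu₀, dist_eq_norm z z₀, sub_zero]
    exact ⟨⟨e4.trans_le (min_le_right _ _), e5.trans_le (min_le_right _ _)⟩,
      hz.trans_le (min_le_right _ _)⟩
  have hEψ : ∀ {h ε : ℝ} {z : C(Turn, ℝ)}, Φ ((h, ε), z) = 0 ↔
      turnEnergy G c z = algebraMap ℝ _ h - ε • turnIntegral (turnLoss f g c ε z) := by
    intro h ε z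
    simp only [hΦ]
    constructor <;> intro H
    · rw [← sub_eq_zero, ← H]; abel
    · rw [H]; abel
  set last : Turn := ⟨2 * π, right_mem_Icc.2 two_pi_pos.le⟩ with hlast
  refine ⟨η, hη, fun p => turnIntegral (turnLoss f g c p.2 (ψ p)) last, ?_, ?_, ?_⟩
  · intro h ε hh hε
    obtain ⟨e1, e2, -, -, e5⟩ := hev' h ε hh hε
    have h1 : ContDiffAt ℝ ω (fun p : ℝ × ℝ => turnLoss f g c p.2 (ψ p)) (h, ε) :=
      ContDiffAt.comp (h, ε) (hloss (e5.trans_le (min_le_left _ _)) (e1.trans_le (min_le_left _ _)))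
        (f := fun p : ℝ × ℝ => (p.2, ψ p)) (contDiffAt_snd.prodMk e2)
    exact ((ContinuousMap.evalCLM ℝ last ∘L turnIntegral).contDiff (n := ω)).contDiffAt.comp _ h1
  · intro h hh
    obtain ⟨e1, -, e3, -, e5⟩ := hev' h 0 hh (by simpa using hη)
    have hz := e1.trans_le (min_le_left _ _)
    refine ⟨ψ (h, 0), fun θ => ⟨htube _ _ _ (by simpa using hδ) (hclose hz θ), ?_⟩, ?_⟩
    · have := DFunLike.congr_fun (hEψ.1 e3) θ
      simpa [turnEnergy_apply] using this
    · exact turnIntegral_turnLoss (fun θ => turnExtend_coe _ θ) (hspeed (by simpa using hδ) hz) last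
  · intro h ε hh hε hεη hD hisol
    have hεabs : |ε| < η := by rwa [abs_of_pos hε]
    obtain ⟨e1, -, e3, -, e5⟩ := hev' h ε hh hεabs
    have hz := e1.trans_le (min_le_left _ _)
    have hεδ := e5.trans_le (min_le_left _ _)
    set z := ψ (h, ε) with hzdef
    have hE := hEψ.1 e3
    have hreg : ∀ θ : Turn, IsRegularAt f g c O ε (z θ) θ := fun θ =>
      htube _ _ _ hεδ (hclose hz θ)
    set first : Turn := ⟨0, left_mem_Icc.2 two_pi_pos.le⟩ with hfirst
    have h0 : z first = z last := by
      have E1 := DFunLike.congr_fun hE first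
      have E2 := DFunLike.congr_fun hE last
      simp only [turnEnergy_apply, ContinuousMap.sub_apply, ContinuousMap.smul_apply] at E1 E2
      replace hD : turnIntegral (turnLoss f g c ε z) last = 0 := hD
      rw [hD] at E2
      have h3 : turnIntegral (turnLoss f g c ε z) first = 0 := by
        rw [turnIntegral_apply]; simp [hfirst]
      rw [h3] at E1
      have hper : ∀ r, polarEnergy G c r last = polarEnergy G c r first := fun r => by
        simp [polarEnergy, hlast, hfirst]
      rw [hper] at E2
      have c1 := hclose hz first
      have c2 := hclose hz last
      have : R₀ last = R₀ first := by simpa [hlast, hfirst] using hp 0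
      rw [this] at c2
      rw [abs_lt] at c1 c2
      refine polarEnergy_injOn hG (θ := first) (a := R₀ first - δ) (b := R₀ first + δ)
        (fun r hr => (htube ε r first hεδ ?_).radial_pos) ⟨by linarith, by linarith⟩
        ⟨by linarith, by linarith⟩ (E1.trans ?_)
      · rw [abs_lt]; exact ⟨by linarith [hr.1], by linarith [hr.2]⟩
      · exact Eq.trans (by simp) E2.symm
    obtain ⟨R, hR, hRp, hRreg, hRz⟩ := exists_isPolarSolution_of_turn hreg h0 hE hD
    have hRR₀ : ∀ θ, |R θ - R₀ θ| ≤ ‖z - z₀‖ := fun θ => by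
      obtain ⟨n, hn⟩ := exists_mem_Ico_add_int θ
      have h1 : R (θ + n * (2 * π)) = R θ := hRp.int_mul n θ
      have h2 : R₀ (θ + n * (2 * π)) = R₀ θ := hp.int_mul n θ
      have h3 := (z - z₀).norm_coe_le_norm ⟨_, Ico_subset_Icc_self hn⟩
      rw [ContinuousMap.sub_apply, ← hRz] at h3
      rw [← h1, ← h2]; exact h3
    refine ⟨range fun θ => polarPoint c (R θ) θ, ⟨hR.isPeriodicOrbit hG hRp, ?_⟩, ?_⟩
    swap
    · rintro - ⟨θ, rfl⟩; exact (hRreg θ).mem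
    obtain ⟨κ, hκ, hisol⟩ := Metric.eventually_nhds_iff.1 (eventually_nhdsWithin_iff.1 hisol)
    have hE0 : polarEnergy G c (R 0) 0 = h := by simpa using hR.energy 0
    have hcont : ContinuousAt (fun r => polarEnergy G c r 0) (R 0) :=
      (hasDerivAt_polarEnergy hG c (R 0) 0).continuousAt
    obtain ⟨d, hd, hdE⟩ := Metric.continuousAt_iff.1 hcont (min κ (η - |h - hs|))
      (lt_min hκ (by linarith))
    set δ₂ := min (min δ δ₁ - ‖z - z₀‖) d with hδ₂
    have hδ₂pos : 0 < δ₂ := lt_min (by linarith) hd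
    have hsmall : ∀ {r θ : ℝ}, |r - R θ| < δ₂ → |r - R₀ θ| < min δ δ₁ := fun {r θ} hr => by
      have h1 := hr.trans_le (min_le_left _ _)
      have h2 := abs_sub_le r (R θ) (R₀ θ)
      linarith [hRR₀ θ]
    have hregU : ∀ r θ, |r - R θ| < δ₂ → IsRegularAt f g c O ε r θ := fun r θ hr =>
      htube _ _ _ hεδ ((hsmall hr).trans_le (min_le_left _ _))
    refine ⟨polarTube c R δ₂, isOpen_polarTube c hR.continuous δ₂, ?_, fun Γ' hΓ' hU => ?_⟩
    · rintro - ⟨θ, rfl⟩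
      exact ⟨R θ, θ, hR.pos θ, by simpa using hδ₂pos, rfl⟩
    obtain ⟨h', R', hR', hR'p, hR'R, rfl⟩ := exists_isPolarSolution hG hRp
      (fun r θ hr _ => (hregU r θ hr).speed_pos) (fun r θ hr _ => (hregU r θ hr).radial_pos) hΓ' hU
    have hE0' : polarEnergy G c (R' 0) 0 = h' := by simpa using hR'.energy 0
    have hdist := hdE (x := R' 0) (by
      rw [Real.dist_eq]; exact (hR'R 0).trans_le (min_le_right _ _))
    rw [hE0, hE0', Real.dist_eq, lt_min_iff] at hdist
    have hh' : |h' - hs| < η := by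
      have := abs_sub_le h' h hs
      linarith [hdist.2]
    set z' : C(Turn, ℝ) := ⟨fun θ => R' θ, hR'.continuous.comp continuous_subtype_val⟩ with hz'
    have hz'z₀ : ‖z' - z₀‖ < min δ δ₁ :=
      (ContinuousMap.norm_lt_iff _ (lt_min hδ hδ₁)).2 fun θ => hsmall (hR'R θ)
    have hint : ∀ θ : Turn, turnIntegral (turnLoss f g c ε z') θ =
        ∫ s in (0 : ℝ)..θ, energyLoss f g c ε (R' s) s :=
      turnIntegral_turnLoss (fun θ => rfl) fun θ => hR'.speed_pos θ
    have hψ' : ψ (h', ε) = z' := by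
      refine huniq hh' hεabs hz'z₀ (hEψ.2 ?_)
      ext θ
      have := hR'.energy θ
      rw [turnEnergy_apply, ContinuousMap.sub_apply, ContinuousMap.smul_apply, hint]
      exact this
    have hD' : turnIntegral (turnLoss f g c ε z') last = 0 := by
      rw [hint]
      have h1 := hR'.energy last
      have h2 : polarEnergy G c (R' last) last = polarEnergy G c (R' 0) 0 := by
        have : R' last = R' 0 := by simpa [hlast] using hR'p 0
        rw [this]; simp [polarEnergy, hlast]
      rw [h2, hE0'] at h1
      have h3 : ε * ∫ s in (0 : ℝ)..last, energyLoss f g c ε (R' s) s = 0 := by linarith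
      exact (mul_eq_zero.1 h3).resolve_left hε.ne'
    have hhh : h' = h := by
      by_contra hne
      refine hisol (y := h') (by rw [Real.dist_eq]; exact hdist.1) hne ?_
      simp only
      rw [hψ']; exact hD'
    have hRR' : R' = R := by
      ext θ
      obtain ⟨n, hn⟩ := exists_mem_Ico_add_int θ
      have h1 : R (θ + n * (2 * π)) = R θ := hRp.int_mul n θ
      have h2 : R' (θ + n * (2 * π)) = R' θ := hR'p.int_mul n θ
      have h3 := hRz ⟨_, Ico_subset_Icc_self hn⟩
      rw [hzdef, ← hhh, hψ'] at h3
      rw [← h1, ← h2, h3]; rfl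
    rw [hRR']

/-! ### Bands of closed level curves -/

/-- The first Melnikov integral over the upper half of the level curve of energy `h`
lying above `[a, b]`. -/
noncomputable def melnikov (f G : ℝ[X]) (a b h : ℝ) : ℝ :=
  ∫ x in a..b, f.eval x * √(2 * (h - G.eval x))

/-- The level curves with energies in `[h₁, h₂]` above `[a, b]` are transverse to the rays
issued from `(c, 0)`. -/
structure IsBand (g G : ℝ[X]) (c a b h₁ h₂ : ℝ) : Prop where
  left_lt : a < c
  lt_right : c < b
  energy_lt : h₁ < h₂
  center : G.eval c < h₁
  left : h₂ ≤ G.eval a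
  right : h₂ ≤ G.eval b
  transverse : ∀ x ∈ Icc a b, ∀ h ∈ Icc h₁ h₂, G.eval x ≤ h →
    0 < (x - c) * g.eval x + 2 * (h - G.eval x)

/-- The part of the plane swept by a band. -/
def bandRegion (G : ℝ[X]) (a b h₁ h₂ : ℝ) : Set (ℝ × ℝ) :=
  {p | p.1 ∈ Ioo a b ∧ p.2 ^ 2 / 2 + G.eval p.1 ∈ Ioo h₁ h₂}

lemma isOpen_bandRegion (G : ℝ[X]) (a b h₁ h₂ : ℝ) : IsOpen (bandRegion G a b h₁ h₂) :=
  (isOpen_Ioo.preimage continuous_fst).inter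
    (isOpen_Ioo.preimage (by fun_prop : Continuous fun p : ℝ × ℝ => p.2 ^ 2 / 2 + G.eval p.1))

lemma polarPoint_mem_bandRegion {G : ℝ[X]} {c a b h₁ h₂ r θ : ℝ} :
    polarPoint c r θ ∈ bandRegion G a b h₁ h₂ ↔
      c + r * cos θ ∈ Ioo a b ∧ polarEnergy G c r θ ∈ Ioo h₁ h₂ := by
  simp only [bandRegion, polarPoint, mem_ofPred_eq, polarEnergy]
  rw [show (-(r * sin θ)) ^ 2 / 2 = r ^ 2 * sin θ ^ 2 / 2 by ring]

/-- A function which is increasing wherever it takes the value `h` takes it only once. -/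
lemma lt_of_deriv_pos_at_level {φ φ' : ℝ → ℝ} {a b h : ℝ} (hφ : ∀ x, HasDerivAt φ (φ' x) x)
    (ha : φ a = h) (hpos : ∀ x ∈ Icc a b, φ x = h → 0 < φ' x) {x : ℝ} (hx : x ∈ Ioc a b) :
    h < φ x := by
  have hge : ∀ y ∈ Icc a b, h ≤ φ y := fun y hy =>
    image_le_of_deriv_right_lt_deriv_boundary (f := fun _ => h) (f' := fun _ => 0)
      continuousOn_const (fun z _ => hasDerivWithinAt_const z _ h) ha.ge hφ
      (fun z hz he => hpos z (Ico_subset_Icc_self hz) he.symm) hy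
  refine (hge x (Ioc_subset_Icc_self hx)).lt_of_ne fun he => ?_
  have hs := (hasDerivAt_iff_tendsto_slope.1 (hφ x)).eventually
    (lt_mem_nhds (hpos x (Ioc_subset_Icc_self hx) he.symm))
  have hs' : ∀ᶠ y in 𝓝[<] x, 0 < slope φ x y :=
    hs.filter_mono (nhdsWithin_mono x fun y (hy : y < x) => hy.ne)
  obtain ⟨y, hy1, hy2⟩ := (hs'.and (Ioo_mem_nhdsLT hx.1)).exists
  have := hge y ⟨hy2.1.le, hy2.2.le.trans hx.2⟩
  rw [slope_def_field] at hy1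
  exact hy1.not_ge (div_nonpos_of_nonneg_of_nonpos (by linarith) (by linarith [hy2.2]))

section Band

variable {f g G : ℝ[X]} {c a b h₁ h₂ h : ℝ}

lemma IsBand.radialDeriv_pos (hB : IsBand g G c a b h₁ h₂) (hh : h ∈ Icc h₁ h₂) {r θ : ℝ}
    (hr : 0 ≤ r) (hx : c + r * cos θ ∈ Icc a b) (hE : polarEnergy G c r θ = h) :
    0 < radialDeriv g c r θ := by
  have h1 : G.eval (c + r * cos θ) ≤ h := by
    rw [← hE, polarEnergy]; nlinarith [sq_nonneg (r * sin θ)]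
  have h2 := hB.transverse _ hx h hh h1
  refine pos_of_mul_pos_right (a := r) ?_ hr
  rw [radialDeriv]
  rw [← hE, polarEnergy] at h2
  linarith

lemma IsBand.mem_Icc (hB : IsBand g G c a b h₁ h₂) {r s θ : ℝ} (hr : 0 ≤ r) (hrs : r ≤ s)
    (hx : c + s * cos θ ∈ Icc a b) : c + r * cos θ ∈ Icc a b := by
  have := hB.left_lt
  have := hB.lt_right
  rcases le_total 0 (cos θ) with h | h
  · exact ⟨by nlinarith, by nlinarith [hx.2]⟩
  · exact ⟨by nlinarith [hx.1], by nlinarith⟩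

lemma IsBand.energy_lt_of_lt (hG : derivative G = g) (hB : IsBand g G c a b h₁ h₂)
    (hh : h ∈ Icc h₁ h₂) {r s θ : ℝ} (hr : 0 ≤ r) (hrs : r < s) (hx : c + s * cos θ ∈ Icc a b)
    (hE : polarEnergy G c r θ = h) : h < polarEnergy G c s θ :=
  lt_of_deriv_pos_at_level (a := r) (b := s) (hasDerivAt_polarEnergy hG c · θ) hE
    (fun _ ht he => hB.radialDeriv_pos hh (hr.trans ht.1) (hB.mem_Icc (hr.trans ht.1) ht.2 hx) he)
    ⟨hrs, le_rfl⟩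

lemma IsBand.radius_unique (hG : derivative G = g) (hB : IsBand g G c a b h₁ h₂)
    (hh : h ∈ Icc h₁ h₂) {r s θ : ℝ} (hr : 0 ≤ r) (hs : 0 ≤ s) (hxr : c + r * cos θ ∈ Icc a b)
    (hxs : c + s * cos θ ∈ Icc a b) (hEr : polarEnergy G c r θ = h)
    (hEs : polarEnergy G c s θ = h) : r = s := by
  rcases lt_trichotomy r s with hlt | rfl | hlt
  · exact absurd hEs (hB.energy_lt_of_lt hG hh hr hlt hxs hEr).ne'
  · rfl
  · exact absurd hEr (hB.energy_lt_of_lt hG hh hs hlt hxr hEs).ne'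

lemma IsBand.exists_radius (hB : IsBand g G c a b h₁ h₂) (hh : h ∈ Ioo h₁ h₂) (θ : ℝ) :
    ∃ r, 0 < r ∧ c + r * cos θ ∈ Ioo a b ∧ polarEnergy G c r θ = h := by
  have h1 := hB.left_lt
  have h2 := hB.lt_right
  have hcont : Continuous fun r => polarEnergy G c r θ :=
    (continuous_polarEnergy G c).comp (by fun_prop : Continuous fun r : ℝ => (r, θ))
  have h0 : polarEnergy G c 0 θ < h := by
    simpa [polarEnergy] using hB.center.trans hh.1
  obtain ⟨s, hs, hsx, hsE⟩ : ∃ s, 0 < s ∧ (∀ r ∈ Ioo 0 s, c + r * cos θ ∈ Ioo a b) ∧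
      h < polarEnergy G c s θ := by
    rcases lt_trichotomy (cos θ) 0 with hc | hc | hc
    · refine ⟨(a - c) / cos θ, div_pos_of_neg_of_neg (by linarith) hc, fun r hr => ?_, ?_⟩
      · have := (lt_div_iff_of_neg hc).1 hr.2
        exact ⟨by linarith, by nlinarith [hr.1]⟩
      · rw [polarEnergy, div_mul_cancel₀ _ hc.ne, add_sub_cancel]
        have := hB.left
        have := hh.2
        nlinarith [sq_nonneg ((a - c) / cos θ * sin θ)]
    · refine ⟨√(2 * (h₂ - G.eval c)), Real.sqrt_pos.2 (by linarith [hB.center, hB.energy_lt]),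
        fun r hr => by rw [hc]; exact ⟨by linarith, by linarith⟩, ?_⟩
      have hs : sin θ ^ 2 = 1 := by rw [sin_sq, hc]; norm_num
      rw [polarEnergy, hs, hc, Real.sq_sqrt (by linarith [hB.center, hB.energy_lt]), mul_zero,
        add_zero]
      linarith [hh.2]
    · refine ⟨(b - c) / cos θ, div_pos (by linarith) hc, fun r hr => ?_, ?_⟩
      · have := (lt_div_iff₀ hc).1 hr.2
        exact ⟨by nlinarith [hr.1], by linarith⟩
      · rw [polarEnergy, div_mul_cancel₀ _ hc.ne', add_sub_cancel]
        have := hB.right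
        have := hh.2
        nlinarith [sq_nonneg ((b - c) / cos θ * sin θ)]
  obtain ⟨r, hr, hrE⟩ := intermediate_value_Ioo hs.le hcont.continuousOn ⟨h0, hsE⟩
  exact ⟨r, hr.1, hsx r hr, hrE⟩

lemma IsBand.exists_isPolarSolution (f : ℝ[X]) (hG : derivative G = g)
    (hB : IsBand g G c a b h₁ h₂) (hh : h ∈ Ioo h₁ h₂) :
    ∃ R, IsPolarSolution f g G c 0 h R ∧ Function.Periodic R (2 * π) ∧
      ∀ θ, c + R θ * cos θ ∈ Ioo a b := by
  choose R hpos hx hE using hB.exists_radius hh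
  have hh' := Ioo_subset_Icc_self hh
  have hx' := fun θ => Ioo_subset_Icc_self (hx θ)
  have hrad := fun θ => hB.radialDeriv_pos hh' (hpos θ).le (hx' θ) (hE θ)
  refine ⟨R, ⟨?_, hpos, fun θ => ?_, hrad, fun θ => by rw [hE]; ring⟩, fun θ => ?_, hx⟩
  · refine continuous_iff_continuousAt.2 fun θ₀ => ?_
    rw [Metric.continuousAt_iff']
    intro e he
    have hnear : ∀ᶠ r in 𝓝 (R θ₀), 0 < r ∧ c + r * cos θ₀ ∈ Ioo a b := by
      refine (lt_mem_nhds (hpos θ₀)).and ?_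
      exact (by fun_prop : Continuous fun r => c + r * cos θ₀).continuousAt.eventually
        (isOpen_Ioo.mem_nhds (hx θ₀))
    obtain ⟨δ, hδ, hball⟩ := Metric.eventually_nhds_iff.1 hnear
    set d := min (e / 2) (δ / 2)
    have hd : 0 < d := by positivity
    have hde : d < e := (min_le_left _ _).trans_lt (by linarith)
    have hdδ : d < δ := (min_le_right _ _).trans_lt (by linarith)
    obtain ⟨hm, hmx⟩ := hball (y := R θ₀ - d) (by rw [Real.dist_eq, abs_lt]; constructor <;> linarith)
    obtain ⟨hp, hpx⟩ := hball (y := R θ₀ + d) (by rw [Real.dist_eq, abs_lt]; constructor <;> linarith)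
    have hEp := hB.energy_lt_of_lt hG hh' (hpos θ₀).le (by linarith : R θ₀ < R θ₀ + d)
      (Ioo_subset_Icc_self hpx) (hE θ₀)
    have hEm : polarEnergy G c (R θ₀ - d) θ₀ < h := by
      by_contra! hcon
      have hcont : Continuous fun r => polarEnergy G c r θ₀ :=
        (continuous_polarEnergy G c).comp (by fun_prop : Continuous fun r : ℝ => (r, θ₀))
      obtain ⟨r, hr, hrE⟩ := intermediate_value_Icc hm.le hcont.continuousOn
        ⟨(by simpa [polarEnergy] using (hB.center.trans hh.1).le), hcon⟩
      have := hB.energy_lt_of_lt hG hh' hr.1 (by linarith [hr.2] : r < R θ₀) (hx' θ₀) hrE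
      linarith [hE θ₀]
    have hcE : ∀ r, Continuous fun θ => polarEnergy G c r θ := fun r =>
      (continuous_polarEnergy G c).comp (by fun_prop : Continuous fun θ : ℝ => (r, θ))
    have hcx : ∀ r, Continuous fun θ => c + r * cos θ := fun r => by fun_prop
    filter_upwards [(hcE (R θ₀ - d)).continuousAt.eventually (gt_mem_nhds hEm),
      (hcE (R θ₀ + d)).continuousAt.eventually (lt_mem_nhds hEp),
      (hcx (R θ₀ + d)).continuousAt.eventually (isOpen_Ioo.mem_nhds hpx)] with θ t1 t2 t3
    have hcont : Continuous fun r => polarEnergy G c r θ :=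
      (continuous_polarEnergy G c).comp (by fun_prop : Continuous fun r : ℝ => (r, θ))
    obtain ⟨r, hr, hrE⟩ := intermediate_value_Ioo (by linarith) hcont.continuousOn ⟨t1, t2⟩
    have := hB.radius_unique hG hh' (hpos θ).le (by linarith [hr.1]) (hx' θ)
      (hB.mem_Icc (by linarith [hr.1]) hr.2.le (Ioo_subset_Icc_self t3)) (hE θ) hrE
    rw [this, Real.dist_eq, abs_lt]
    constructor <;> linarith [hr.1, hr.2]
  · have := hrad θ
    rw [radialDeriv] at this
    rw [angularSpeed]
    linarith
  · refine hB.radius_unique (θ := θ) hG hh' (hpos _).le (hpos _).le ?_ (hx' θ) ?_ (hE θ)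
    · simpa using hx' (θ + 2 * π)
    · simpa [polarEnergy] using hE (θ + 2 * π)

end Band

section Melnikov

variable {f g G : ℝ[X]} {c a b h₁ h₂ h : ℝ}

lemma continuous_melnikov_integrand (f G : ℝ[X]) (h : ℝ) :
    Continuous fun x => f.eval x * √(2 * (h - G.eval x)) := by fun_prop

lemma continuous_melnikov (f G : ℝ[X]) (a b : ℝ) : Continuous (melnikov f G a b) :=
  intervalIntegral.continuous_parametric_intervalIntegral_of_continuous'
    (by fun_prop : Continuous fun p : ℝ × ℝ => f.eval p.2 * √(2 * (p.1 - G.eval p.2))) a b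

lemma IsPolarSolution.hasDerivAt_fst (hG : derivative G = g) {R : ℝ → ℝ}
    (hR : IsPolarSolution f g G c 0 h R) (θ : ℝ) :
    HasDerivAt (fun θ => c + R θ * cos θ)
      (-(R θ ^ 2 * sin θ) / angularSpeed f g c 0 (R θ) θ) θ := by
  have h1 := ((hR.hasDerivAt hG θ).fun_mul (hasDerivAt_cos θ)).const_add c
  convert! h1 using 1
  have := (hR.speed_pos θ).ne'
  field_simp
  rw [angularSpeed]
  linear_combination (R θ ^ 2 * sin θ) * sin_sq_add_cos_sq θ

lemma IsPolarSolution.sqrt_energy {R : ℝ → ℝ} (hR : IsPolarSolution f g G c 0 h R) (θ : ℝ) :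
    √(2 * (h - G.eval (c + R θ * cos θ))) = R θ * |sin θ| := by
  have h1 := hR.energy θ
  rw [polarEnergy] at h1
  rw [show 2 * (h - G.eval (c + R θ * cos θ)) = (R θ * sin θ) ^ 2 by linarith,
    Real.sqrt_sq_eq_abs, abs_mul, abs_of_pos (hR.pos θ)]

lemma IsPolarSolution.integral_energyLoss_of_abs_sin (hG : derivative G = g) {R : ℝ → ℝ}
    (hR : IsPolarSolution f g G c 0 h R) {s t σ : ℝ}
    (hσ : ∀ θ ∈ uIcc s t, |sin θ| = σ * sin θ) (hσ' : σ * σ = 1) :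
    ∫ θ in s..t, energyLoss f g c 0 (R θ) θ =
      -σ * ∫ x in (c + R s * cos s)..(c + R t * cos t), f.eval x * √(2 * (h - G.eval x)) := by
  have hRc := hR.continuous
  have hsub := intervalIntegral.integral_comp_mul_deriv (a := s) (b := t)
    (f := fun θ => c + R θ * cos θ)
    (f' := fun θ => -(R θ ^ 2 * sin θ) / angularSpeed f g c 0 (R θ) θ)
    (fun θ _ => hR.hasDerivAt_fst hG θ)
    (Continuous.continuousOn <| (by fun_prop : Continuous fun θ => -(R θ ^ 2 * sin θ)).div
      hR.continuous_speed fun θ => (hR.speed_pos θ).ne')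
    (continuous_melnikov_integrand f G h)
  rw [← hsub, ← intervalIntegral.integral_const_mul]
  refine intervalIntegral.integral_congr fun θ hθ => ?_
  simp only [Function.comp_apply, hR.sqrt_energy, hσ θ hθ, energyLoss]
  have := (hR.speed_pos θ).ne'
  field_simp
  linear_combination (-(R θ ^ 3 * f.eval (c + R θ * cos θ) * sin θ ^ 2)) * hσ'

lemma IsBand.le_eval (hG : derivative G = g) (hB : IsBand g G c a b h₁ h₂) (hh : h ∈ Icc h₁ h₂)
    {θ r x : ℝ} (hθ : cos θ = 1 ∨ cos θ = -1) (hr : 0 ≤ r) (hE : polarEnergy G c r θ = h)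
    (hx : x ∈ Icc a b) (hrx : r ≤ (x - c) * cos θ) : h ≤ G.eval x := by
  have hsin : sin θ = 0 := by
    rw [← sq_eq_zero_iff, sin_sq]; rcases hθ with h | h <;> rw [h] <;> norm_num
  have hcc : (x - c) * cos θ * cos θ = x - c := by
    rcases hθ with h | h <;> rw [h] <;> ring
  have hval : polarEnergy G c ((x - c) * cos θ) θ = G.eval x := by
    rw [polarEnergy, hsin, hcc]; ring_nf
  rcases hrx.eq_or_lt with he | hlt
  · rw [← hval, ← he, hE]
  · rw [← hval]
    exact (hB.energy_lt_of_lt hG hh hr hlt (by rw [hcc]; simpa using hx) hE).le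

lemma IsBand.integral_energyLoss (hG : derivative G = g) (hB : IsBand g G c a b h₁ h₂)
    (hh : h ∈ Icc h₁ h₂) {R : ℝ → ℝ} (hR : IsPolarSolution f g G c 0 h R)
    (hp : Function.Periodic R (2 * π)) (hx : ∀ θ, c + R θ * cos θ ∈ Ioo a b) :
    ∫ θ in (0 : ℝ)..(2 * π), energyLoss f g c 0 (R θ) θ = 2 * melnikov f G a b h := by
  have hE : ∀ θ, polarEnergy G c (R θ) θ = h := fun θ => by rw [hR.energy]; ring
  have hup := hR.integral_energyLoss_of_abs_sin hG (s := 0) (t := π) (σ := 1) (fun θ hθ => by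
    rw [uIcc_of_le pi_pos.le] at hθ
    rw [one_mul, abs_of_nonneg (sin_nonneg_of_mem_Icc hθ)]) (by norm_num)
  have hdown := hR.integral_energyLoss_of_abs_sin hG (s := π) (t := 2 * π) (σ := -1)
    (fun θ hθ => by
      rw [uIcc_of_le (by linarith [pi_pos])] at hθ
      have := sin_nonneg_of_mem_Icc (x := θ - π) ⟨by linarith [hθ.1], by linarith [hθ.2]⟩
      rw [sin_sub_pi] at this
      rw [abs_of_nonpos (by linarith)]; ring) (by norm_num)
  have hR0 : R (2 * π) = R 0 := by simpa using hp 0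
  have x0 := hx 0
  have xπ := hx π
  simp only [cos_zero, cos_pi, cos_two_pi, hR0, mul_one] at hup hdown x0 xπ
  have hFi := fun s t => (continuous_melnikov_integrand f G h).intervalIntegrable
    (μ := MeasureTheory.volume) s t
  have hLi := fun s t => (hR.continuous_loss).intervalIntegrable (μ := MeasureTheory.volume) s t
  have hzero : ∀ s t, (∀ x ∈ uIcc s t, h ≤ G.eval x) →
      ∫ x in s..t, f.eval x * √(2 * (h - G.eval x)) = 0 := fun s t hst =>
    intervalIntegral.integral_zero_ae <| .of_forall fun x hx => by
      rw [Real.sqrt_eq_zero_of_nonpos (by linarith [hst x (uIoc_subset_uIcc hx)]), mul_zero]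
  have hl := hzero a (c + R π * -1) fun x hx' => by
    rw [uIcc_of_le xπ.1.le] at hx'
    refine hB.le_eval hG hh (θ := π) (by simp) (hR.pos π).le (hE π)
      ⟨hx'.1, hx'.2.trans xπ.2.le⟩ ?_
    rw [cos_pi]; linarith [hx'.2]
  have hr := hzero (c + R 0) b fun x hx' => by
    rw [uIcc_of_le x0.2.le] at hx'
    refine hB.le_eval hG hh (θ := 0) (by simp) (hR.pos 0).le (hE 0)
      ⟨x0.1.le.trans hx'.1, hx'.2⟩ ?_
    rw [cos_zero]; linarith [hx'.1]
  rw [← intervalIntegral.integral_add_adjacent_intervals (hLi 0 π) (hLi π (2 * π)), hup, hdown,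
    intervalIntegral.integral_symm (c + R π * -1) (c + R 0), melnikov,
    ← intervalIntegral.integral_add_adjacent_intervals (hFi a (c + R π * -1)) (hFi _ b),
    ← intervalIntegral.integral_add_adjacent_intervals (hFi _ (c + R 0)) (hFi _ b), hl, hr]
  ring

open scoped ContDiff in
/-- A band carries a chart of return maps around each of its level curves. -/
lemma IsBand.exists_chart (f : ℝ[X]) (hG : derivative G = g) (hB : IsBand g G c a b h₁ h₂)
    {hs : ℝ} (hh : hs ∈ Ioo h₁ h₂) :
    ∃ η, 0 < η ∧ ∃ D : ℝ × ℝ → ℝ,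
      (∀ h ε, |h - hs| < η → |ε| < η → ContDiffAt ℝ ω D (h, ε)) ∧
      (∀ h, |h - hs| < η → h ∈ Ioo h₁ h₂ ∧ D (h, 0) = 2 * melnikov f G a b h) ∧
      ∀ h ε, |h - hs| < η → 0 < ε → ε < η → D (h, ε) = 0 → (∀ᶠ h' in 𝓝[≠] h, D (h', ε) ≠ 0) →
        ∃ Γ, IsLimitCycle (lienard f g ε) Γ ∧ Γ ⊆ bandRegion G a b h₁ h₂ := by
  obtain ⟨R₀, h₀, hp, hx⟩ := hB.exists_isPolarSolution f hG hh
  have hmem : ∀ θ, polarPoint c (R₀ θ) θ ∈ bandRegion G a b h₁ h₂ := fun θ =>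
    polarPoint_mem_bandRegion.2 ⟨hx θ, by rw [h₀.energy]; simpa using hh⟩
  obtain ⟨η, hη, D, hD, hD0, hDl⟩ :=
    _root_.exists_chart hG (isOpen_bandRegion G a b h₁ h₂) h₀ hp hmem
  refine ⟨η, hη, D, hD, fun h hh' => ?_, hDl⟩
  obtain ⟨z, hz, hzD⟩ := hD0 h hh'
  have hhI : h ∈ Ioo h₁ h₂ := by
    have := (polarPoint_mem_bandRegion.1 (hz ⟨0, by simp [pi_pos.le]⟩).1.mem).2
    rwa [(hz _).2] at this
  refine ⟨hhI, ?_⟩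
  obtain ⟨R, hR, hRp, hRx⟩ := hB.exists_isPolarSolution f hG hhI
  rw [hzD, ← hB.integral_energyLoss hG (Ioo_subset_Icc_self hhI) hR hRp hRx]
  refine intervalIntegral.integral_congr fun s hs => ?_
  rw [uIcc_of_le two_pi_pos.le] at hs
  have hzs := hz ⟨s, hs⟩
  have : turnExtend z s = R s := by
    rw [turnExtend_of_mem _ hs]
    refine hB.radius_unique hG (Ioo_subset_Icc_self hhI) hzs.1.pos.le (hR.pos s).le
      (Ioo_subset_Icc_self (polarPoint_mem_bandRegion.1 hzs.1.mem).1)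
      (Ioo_subset_Icc_self (hRx s)) hzs.2 ?_
    rw [hR.energy]; ring
  simp only [this]

end Melnikov

/-! ### Limit cycles inside a band -/

lemma exists_analytic_sign_change {M : ℝ → ℝ} {h₁ h₂ : ℝ} (hlt : h₁ < h₂) (hM : Continuous M)
    (han : ∀ h ∈ Ioo h₁ h₂, AnalyticAt ℝ M h) (hneg : M h₁ < 0) (hpos : 0 < M h₂) :
    ∃ s ∈ Ioo h₁ h₂, ∀ δ > 0, ∃ p q, |p - s| < δ ∧ |q - s| < δ ∧ M p * M q < 0 := by
  set S := {h | h ∈ Icc h₁ h₂ ∧ M h < 0}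
  have hne : S.Nonempty := ⟨h₁, left_mem_Icc.2 hlt.le, hneg⟩
  have hbdd : BddAbove S := ⟨h₂, fun h hh => hh.1.2⟩
  have hcl : sSup S ∈ closure S := csSup_mem_closure hne hbdd
  have hMs : M (sSup S) ≤ 0 :=
    closure_minimal (fun h hh => hh.2.le : S ⊆ {h | M h ≤ 0})
      (isClosed_le hM continuous_const) hcl
  have hs2 : sSup S < h₂ := (csSup_le hne fun h hh => hh.1.2).lt_of_ne fun he => by
    rw [he] at hMs; linarith
  have hs1 : h₁ < sSup S := by
    have hev : ∀ᶠ y in 𝓝[>] h₁, M y < 0 :=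
      (hM.continuousAt.eventually (gt_mem_nhds hneg)).filter_mono nhdsWithin_le_nhds
    obtain ⟨y, hy1, hy2⟩ := (hev.and (Ioo_mem_nhdsGT hlt)).exists
    exact hy2.1.trans_le (le_csSup hbdd ⟨Ioo_subset_Icc_self hy2, hy1⟩)
  have hfreq : ∃ᶠ y in 𝓝 (sSup S), M y < 0 :=
    (mem_closure_iff_frequently.1 hcl).mono fun y hy => hy.2
  refine ⟨sSup S, ⟨hs1, hs2⟩, fun δ hδ => ?_⟩
  have hball : ∀ᶠ y in 𝓝 (sSup S), |y - sSup S| < δ := Metric.ball_mem_nhds _ hδ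
  obtain ⟨p, hp, hpδ⟩ := (hfreq.and_eventually hball).exists
  rcases (han _ ⟨hs1, hs2⟩).eventually_eq_zero_or_eventually_ne_zero with h0 | h0
  · obtain ⟨y, hy1, hy2⟩ := (hfreq.and_eventually h0).exists
    linarith
  · have h0' : ∀ᶠ y in 𝓝[>] (sSup S), M y ≠ 0 :=
      h0.filter_mono (nhdsWithin_mono _ fun y (hy : sSup S < y) => hy.ne')
    obtain ⟨q, ⟨hq0, hqδ⟩, hqI⟩ :=
      ((h0'.and (hball.filter_mono nhdsWithin_le_nhds)).and (Ioo_mem_nhdsGT hs2)).exists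
    refine ⟨p, q, hpδ, hqδ, mul_neg_of_neg_of_pos hp (hq0.symm.lt_of_le ?_)⟩
    by_contra! hlt
    exact (le_csSup hbdd ⟨⟨(hs1.trans hqI.1).le, hqI.2.le⟩, hlt⟩).not_gt hqI.1

lemma exists_analytic_sign_change' {M : ℝ → ℝ} {h₁ h₂ : ℝ} (hlt : h₁ < h₂) (hM : Continuous M)
    (han : ∀ h ∈ Ioo h₁ h₂, AnalyticAt ℝ M h) (hsign : M h₁ * M h₂ < 0) :
    ∃ s ∈ Ioo h₁ h₂, ∀ δ > 0, ∃ p q, |p - s| < δ ∧ |q - s| < δ ∧ M p * M q < 0 := by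
  rcases mul_neg_iff.1 hsign with ⟨h1, h2⟩ | ⟨h1, h2⟩
  · obtain ⟨s, hs, H⟩ := exists_analytic_sign_change (M := fun h => -M h) hlt hM.neg
      (fun h hh => (han h hh).neg) (by simpa using h1) (by simpa using h2)
    exact ⟨s, hs, fun δ hδ => by simpa using H δ hδ⟩
  · exact exists_analytic_sign_change hlt hM han h1 h2

/-- An analytic function on an interval which changes sign has an isolated zero. -/
lemma exists_isolated_zero {D : ℝ → ℝ} {u v p q : ℝ} (hD : AnalyticOnNhd ℝ D (Ioo u v))
    (hp : p ∈ Ioo u v) (hq : q ∈ Ioo u v) (hpq : D p * D q < 0) :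
    ∃ h ∈ Ioo u v, D h = 0 ∧ ∀ᶠ h' in 𝓝[≠] h, D h' ≠ 0 := by
  have hord := (isPreconnected_Ioo.image D hD.continuousOn).ordConnected
  obtain ⟨h, hh, hh0⟩ : (0 : ℝ) ∈ D '' Ioo u v := by
    rcases mul_neg_iff.1 hpq with ⟨h1, h2⟩ | ⟨h1, h2⟩
    · exact hord.out (mem_image_of_mem D hq) (mem_image_of_mem D hp) ⟨h2.le, h1.le⟩
    · exact hord.out (mem_image_of_mem D hp) (mem_image_of_mem D hq) ⟨h1.le, h2.le⟩
  refine ⟨h, hh, hh0, ?_⟩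
  by_contra hcon
  have h0 := hD.eqOn_zero_of_preconnected_of_frequently_eq_zero isPreconnected_Ioo hh
    ((not_eventually.1 hcon).mono fun _ => not_not.1)
  rw [h0 hp] at hpq
  simp at hpq

open scoped ContDiff in
/-- A band on whose two boundary curves the Melnikov integral has opposite signs contains a
limit cycle for every small `ε > 0`. -/
theorem IsBand.exists_isLimitCycle {f g G : ℝ[X]} {c a b h₁ h₂ : ℝ} (hG : derivative G = g)
    (hB : IsBand g G c a b h₁ h₂) (hsign : melnikov f G a b h₁ * melnikov f G a b h₂ < 0) :
    ∀ᶠ ε in 𝓝[>] (0 : ℝ), ∃ Γ, IsLimitCycle (lienard f g ε) Γ ∧ Γ ⊆ bandRegion G a b h₁ h₂ := by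
  have han : ∀ h ∈ Ioo h₁ h₂, AnalyticAt ℝ (melnikov f G a b) h := fun h hh => by
    obtain ⟨η, hη, D, hD, hD0, -⟩ := hB.exists_chart f hG hh
    have h1 : ContDiffAt ℝ ω (fun h' => D (h', 0)) h :=
      (hD h 0 (by simpa) (by simpa)).comp h (f := fun h' : ℝ => (h', (0 : ℝ)))
        (contDiffAt_id.prodMk contDiffAt_const)
    refine ((analyticAt_const (v := (1 / 2 : ℝ))).fun_mul h1.analyticAt).congr ?_
    filter_upwards [Metric.ball_mem_nhds h hη] with h' hh'
    rw [(hD0 h' hh').2]; ring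
  obtain ⟨s, hs, hpq⟩ := exists_analytic_sign_change' hB.energy_lt (continuous_melnikov f G a b)
    han hsign
  obtain ⟨η, hη, D, hD, hD0, hDl⟩ := hB.exists_chart f hG hs
  obtain ⟨p, q, hp, hq, hpq⟩ := hpq η hη
  have hcont : ∀ h, |h - s| < η → ContinuousAt (fun ε => D (h, ε)) 0 := fun h hh =>
    ContinuousAt.comp (f := fun ε : ℝ => (h, ε)) (hD h 0 hh (by simpa)).continuousAt
      (by fun_prop)
  have hev : ∀ᶠ ε in 𝓝 (0 : ℝ), D (p, ε) * D (q, ε) < 0 := by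
    refine ((hcont p hp).mul (hcont q hq)).eventually (gt_mem_nhds ?_)
    simp only [Pi.mul_apply, (hD0 p hp).2, (hD0 q hq).2]; linarith
  have hmem : ∀ h, |h - s| < η ↔ h ∈ Ioo (s - η) (s + η) := fun h => by
    rw [abs_lt]; constructor <;> rintro ⟨h1, h2⟩ <;> constructor <;> linarith
  filter_upwards [hev.filter_mono nhdsWithin_le_nhds, Ioo_mem_nhdsGT hη] with ε hε hεη
  have hDan : AnalyticOnNhd ℝ (fun h => D (h, ε)) (Ioo (s - η) (s + η)) := fun h hh => by
    have h1 : ContDiffAt ℝ ω (fun h' => D (h', ε)) h :=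
      (hD h ε ((hmem h).2 hh) (by rw [abs_of_pos hεη.1]; exact hεη.2)).comp h
        (f := fun h' : ℝ => (h', ε)) (contDiffAt_id.prodMk contDiffAt_const)
    exact h1.analyticAt
  obtain ⟨h, hh, h0, hiso⟩ := exists_isolated_zero hDan ((hmem p).1 hp) ((hmem q).1 hq) hε
  exact hDl h ε ((hmem h).2 hh) hεη.1 hεη.2 h0 hiso

/-! ### Pulling bands back by `u ↦ u² - A` -/

lemma melnikov_add_C_mul (f e G : ℝ[X]) (a b h δ : ℝ) :
    melnikov (f + C δ * e) G a b h = melnikov f G a b h + δ * melnikov e G a b h := by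
  have hi := fun q : ℝ[X] => (continuous_melnikov_integrand q G h).intervalIntegrable
    (μ := MeasureTheory.volume) a b
  rw [melnikov, melnikov, melnikov, ← intervalIntegral.integral_const_mul,
    ← intervalIntegral.integral_add (hi f) ((hi e).const_mul δ)]
  refine intervalIntegral.integral_congr fun x _ => ?_
  simp only [eval_add, eval_mul, eval_C]
  ring

/-- The pull back of a `1`-form `p dx` by `u ↦ u² - A`. -/
noncomputable def squarePullback (A : ℝ) (p : ℝ[X]) : ℝ[X] :=
  C 2 * X * p.comp (X ^ 2 - C A)

lemma eval_squarePullback (A : ℝ) (p : ℝ[X]) (u : ℝ) :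
    (squarePullback A p).eval u = 2 * u * p.eval (u ^ 2 - A) := by
  simp [squarePullback]

lemma natDegree_squarePullback_le {A : ℝ} {p : ℝ[X]} {n : ℕ} (hp : p.natDegree ≤ n) :
    (squarePullback A p).natDegree ≤ 2 * n + 1 := by
  have h1 : (C (2 : ℝ) * X).natDegree ≤ 1 := (natDegree_C_mul_le 2 X).trans natDegree_X_le
  have h2 : (p.comp (X ^ 2 - C A)).natDegree ≤ n * 2 := by
    rw [natDegree_comp, natDegree_X_pow_sub_C]
    exact Nat.mul_le_mul_right 2 hp
  exact natDegree_mul_le.trans (by omega)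

lemma derivative_comp_square {g G : ℝ[X]} (hG : derivative G = g) (A : ℝ) :
    derivative (G.comp (X ^ 2 - C A)) = squarePullback A g := by
  rw [derivative_comp, hG, squarePullback]
  congr 1
  rw [derivative_sub, derivative_X_pow, derivative_C, sub_zero]
  simp

lemma melnikov_squarePullback (f G : ℝ[X]) (A s t h : ℝ) :
    melnikov (squarePullback A f) (G.comp (X ^ 2 - C A)) s t h =
      melnikov f G (s ^ 2 - A) (t ^ 2 - A) h := by
  have := intervalIntegral.integral_comp_mul_deriv (a := s) (b := t)
    (f := fun u => u ^ 2 - A) (f' := fun u => 2 * u)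
    (fun u _ => by simpa using (hasDerivAt_pow 2 u).sub_const A)
    (by fun_prop) (continuous_melnikov_integrand f G h)
  rw [melnikov, melnikov, ← this]
  refine intervalIntegral.integral_congr fun u _ => ?_
  simp only [Function.comp_apply, eval_squarePullback, eval_comp, eval_sub, eval_pow, eval_X,
    eval_C]
  ring

section Pullback

variable {g G : ℝ[X]} {c a b h₁ h₂ : ℝ}

lemma IsBand.mirror (hB : IsBand g G c a b h₁ h₂) (hg : ∀ x, g.eval (-x) = -g.eval x)
    (hG : ∀ x, G.eval (-x) = G.eval x) : IsBand g G (-c) (-b) (-a) h₁ h₂ where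
  left_lt := neg_lt_neg hB.lt_right
  lt_right := neg_lt_neg hB.left_lt
  energy_lt := hB.energy_lt
  center := by rw [hG]; exact hB.center
  left := by rw [hG]; exact hB.right
  right := by rw [hG]; exact hB.left
  transverse x hx h hh hle := by
    have := hB.transverse (-x) ⟨by linarith [hx.2], by linarith [hx.1]⟩ h hh (by rwa [hG])
    rw [hG, hg] at this
    linarith

lemma IsBand.exists_margin (hB : IsBand g G c a b h₁ h₂) :
    ∃ m > 0, ∀ x ∈ Icc a b, ∀ h ∈ Icc h₁ h₂, G.eval x ≤ h →
      m ≤ (x - c) * g.eval x + 2 * (h - G.eval x) := by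
  set K : Set (ℝ × ℝ) := (Icc a b ×ˢ Icc h₁ h₂) ∩ {p | G.eval p.1 ≤ p.2}
  have hK : IsCompact K := (isCompact_Icc.prod isCompact_Icc).inter_right
    (isClosed_le (by fun_prop) continuous_snd)
  have hcont : Continuous fun p : ℝ × ℝ => (p.1 - c) * g.eval p.1 + 2 * (p.2 - G.eval p.1) := by
    fun_prop
  rcases K.eq_empty_or_nonempty with he | hne
  · refine ⟨1, one_pos, fun x hx h hh hle => ?_⟩
    have : (x, h) ∈ K := ⟨⟨hx, hh⟩, hle⟩
    rw [he] at this
    exact this.elim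
  · obtain ⟨p, hp, hmin⟩ := hK.exists_isMinOn hne hcont.continuousOn
    exact ⟨_, hB.transverse p.1 hp.1.1 p.2 hp.1.2 hp.2, fun x hx h hh hle =>
      hmin (show (x, h) ∈ K from ⟨⟨hx, hh⟩, hle⟩)⟩

lemma IsBand.eventually_squarePullback (hB : IsBand g G c a b h₁ h₂) :
    ∀ᶠ A in atTop, 0 < a + A ∧ IsBand (squarePullback A g) (G.comp (X ^ 2 - C A))
      √(c + A) √(a + A) √(b + A) h₁ h₂ := by
  obtain ⟨m, hm, hmin⟩ := hB.exists_margin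
  obtain ⟨K, hK⟩ := isCompact_Icc.exists_bound_of_continuousOn (s := Icc a b)
    (f := fun x => (x - c) ^ 2 * g.eval x) (Continuous.continuousOn (by fun_prop))
  filter_upwards [eventually_gt_atTop (-a), eventually_gt_atTop (K / m - a)] with A hA hAK
  have hac := hB.left_lt
  have hcb := hB.lt_right
  have ha : 0 < a + A := by linarith
  have hev : ∀ x, 0 < x + A → (G.comp (X ^ 2 - C A)).eval √(x + A) = G.eval x := fun x hx => by
    simp [Real.sq_sqrt hx.le]
  refine ⟨ha, Real.sqrt_lt_sqrt ha.le (by linarith), Real.sqrt_lt_sqrt (by linarith) (by linarith),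
    hB.energy_lt, ?_, ?_, ?_, fun u hu h hh hle => ?_⟩
  · rw [hev c (by linarith)]; exact hB.center
  · rw [hev a ha]; exact hB.left
  · rw [hev b (by linarith)]; exact hB.right
  · have hs0 : 0 < √(c + A) := Real.sqrt_pos.2 (by linarith)
    have hu0 : 0 < u := (Real.sqrt_pos.2 ha).trans_le hu.1
    have hs2 := Real.sq_sqrt (show 0 ≤ c + A by linarith)
    have hua : a + A ≤ u ^ 2 := (Real.sqrt_le_left hu0.le).1 hu.1
    have hub : u ^ 2 ≤ b + A := (Real.le_sqrt hu0.le (by linarith)).1 hu.2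
    simp only [eval_comp, eval_sub, eval_pow, eval_X, eval_C, eval_squarePullback] at hle ⊢
    have hx : u ^ 2 - A ∈ Icc a b := ⟨by linarith, by linarith⟩
    have h1 := hmin _ hx h hh hle
    have h2 := hK _ hx
    set s := √(c + A)
    set x := u ^ 2 - A with hxdef
    have hxs : x - c = (u - s) * (u + s) := by rw [hxdef]; linear_combination hs2
    have key : (u - s) * (2 * u * g.eval x) =
        (x - c) * g.eval x + (x - c) ^ 2 * g.eval x / (u + s) ^ 2 := by
      have : u + s ≠ 0 := by positivity
      field_simp
      rw [hxs]; ring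
    have h3 : -m < (x - c) ^ 2 * g.eval x / (u + s) ^ 2 := by
      rw [lt_div_iff₀ (by positivity)]
      have h4 : K < m * (a + A) := by
        rw [sub_lt_iff_lt_add, div_lt_iff₀ hm] at hAK; linarith
      have h5 : m * (a + A) ≤ m * (u + s) ^ 2 := by
        refine mul_le_mul_of_nonneg_left ?_ hm.le
        nlinarith
      have := (abs_le.1 h2).1
      linarith
    rw [key]
    linarith

lemma bandRegion_squarePullback {A : ℝ} (ha : 0 < a + A) {p : ℝ × ℝ}
    (hp : p ∈ bandRegion (G.comp (X ^ 2 - C A)) √(a + A) √(b + A) h₁ h₂) :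
    0 < p.1 ∧ (p.1 ^ 2 - A, p.2) ∈ bandRegion G a b h₁ h₂ := by
  obtain ⟨⟨h1, h2⟩, h3⟩ := hp
  have h0 : 0 < p.1 := (Real.sqrt_pos.2 ha).trans h1
  refine ⟨h0, ⟨?_, ?_⟩, by simpa using h3⟩
  · have := (Real.sqrt_lt' h0).1 h1
    simp only; linarith
  · have := (Real.lt_sqrt h0.le).1 h2
    simp only; linarith

lemma bandRegion_mirror (hG : ∀ x, G.eval (-x) = G.eval x) {p : ℝ × ℝ}
    (hp : p ∈ bandRegion G (-b) (-a) h₁ h₂) : (-p.1, p.2) ∈ bandRegion G a b h₁ h₂ := by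
  obtain ⟨⟨h1, h2⟩, h3⟩ := hp
  exact ⟨⟨by simp only; linarith, by simp only; linarith⟩, by simpa [hG] using h3⟩

end Pullback

/-! ### Outer level curves of a coercive potential -/

section Outer

variable {G : ℝ[X]}

/-- The Melnikov integral over the whole upper half of the level set of energy `h`. -/
noncomputable def fullMelnikov (f G : ℝ[X]) (h : ℝ) : ℝ :=
  ∫ x, f.eval x * √(2 * (h - G.eval x))

lemma integrable_melnikov_integrand (hG : Tendsto (fun x => G.eval x) (cocompact ℝ) atTop)
    (f : ℝ[X]) (h : ℝ) : MeasureTheory.Integrable fun x => f.eval x * √(2 * (h - G.eval x)) := by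
  refine (continuous_melnikov_integrand f G h).integrable_of_hasCompactSupport ?_
  rw [hasCompactSupport_iff_eventuallyEq, coclosedCompact_eq_cocompact]
  filter_upwards [hG.eventually_ge_atTop h] with x hx
  rw [Real.sqrt_eq_zero_of_nonpos (by linarith), mul_zero]
  rfl

lemma eventually_forall_le_abs {P : ℝ → Prop} (hP : ∀ᶠ x in cocompact ℝ, P x) :
    ∀ᶠ B in atTop, ∀ x, B ≤ |x| → P x := by
  rw [cocompact_eq_atBot_atTop, eventually_sup, eventually_atBot, eventually_atTop] at hP
  obtain ⟨⟨a, ha⟩, b, hb⟩ := hP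
  filter_upwards [eventually_ge_atTop (-a), eventually_ge_atTop b] with B h1 h2 x hx
  rcases le_abs.1 hx with h | h
  · exact hb x (h2.trans h)
  · exact ha x (by linarith)

lemma eventually_le_eval_of_le_abs (hG : Tendsto (fun x => G.eval x) (cocompact ℝ) atTop)
    (h : ℝ) : ∀ᶠ B in atTop, ∀ x, B ≤ |x| → h ≤ G.eval x :=
  eventually_forall_le_abs (hG.eventually_ge_atTop h)

lemma eventually_fullMelnikov_eq (hG : Tendsto (fun x => G.eval x) (cocompact ℝ) atTop)
    (f : ℝ[X]) (h : ℝ) : ∀ᶠ B in atTop, melnikov f G (-B) B h = fullMelnikov f G h := by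
  filter_upwards [eventually_le_eval_of_le_abs hG h] with B hB
  refine intervalIntegral.integral_eq_integral_of_support_subset fun x hx => ?_
  by_contra hcon
  refine hx ?_
  have : h ≤ G.eval x := hB x <| by
    rw [le_abs]
    rw [mem_Ioc, not_and_or, not_lt, not_le] at hcon
    rcases hcon with h1 | h1
    · right; linarith
    · left; exact h1.le
  simp only
  rw [Real.sqrt_eq_zero_of_nonpos (by linarith), mul_zero]

lemma fullMelnikov_C_mul_add (hG : Tendsto (fun x => G.eval x) (cocompact ℝ) atTop)
    (f e : ℝ[X]) (h s t : ℝ) : fullMelnikov (C s * f + C t * e) G h =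
      s * fullMelnikov f G h + t * fullMelnikov e G h := by
  have hi := fun q => integrable_melnikov_integrand hG q h
  rw [fullMelnikov, fullMelnikov, fullMelnikov, ← MeasureTheory.integral_const_mul,
    ← MeasureTheory.integral_const_mul,
    ← MeasureTheory.integral_add ((hi f).const_mul s) ((hi e).const_mul t)]
  refine MeasureTheory.integral_congr_ae (.of_forall fun x => ?_)
  simp only [eval_add, eval_mul, eval_C]
  ring

lemma exists_abs_le_of_abs_le {φ : ℝ → ℝ} (hφ : Continuous φ) (r : ℝ) :
    ∃ K > 0, ∀ x, |x| ≤ r → |φ x| ≤ K := by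
  obtain ⟨K, hK⟩ := isCompact_Icc.exists_bound_of_continuousOn (s := Icc (-r) r)
    (f := φ) hφ.continuousOn
  exact ⟨max K 1, by positivity, fun x hx => (hK x (abs_le.1 hx)).trans (le_max_left _ _)⟩

/-- On large level curves, a polynomial which is positive at infinity has positive Melnikov
integral. -/
lemma eventually_fullMelnikov_pos (hG : Tendsto (fun x => G.eval x) (cocompact ℝ) atTop)
    {p : ℝ[X]} (hp : ∀ᶠ x in cocompact ℝ, 1 ≤ p.eval x) :
    ∀ᶠ h in atTop, 0 < fullMelnikov p G h := by
  obtain ⟨R, hR, hR0⟩ := ((eventually_forall_le_abs hp).and (eventually_gt_atTop 0)).exists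
  obtain ⟨K, hK0, hK⟩ : ∃ K > 0, ∀ x, -K ≤ G.eval x := by
    obtain ⟨r, hr⟩ := (eventually_le_eval_of_le_abs hG 0).exists
    obtain ⟨K, hK0, hK⟩ := exists_abs_le_of_abs_le G.continuous r
    refine ⟨K, hK0, fun x => ?_⟩
    rcases le_total r |x| with h | h
    · linarith [hr x h]
    · exact (abs_le.1 (hK x h)).1
  obtain ⟨P, hP0, hP⟩ := exists_abs_le_of_abs_le p.continuous R
  set L := 4 * (P * R) + 1
  have hL : 0 < L := by positivity
  obtain ⟨K', hK'0, hK'⟩ := exists_abs_le_of_abs_le G.continuous (R + L)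
  filter_upwards [eventually_gt_atTop (4 * K' + K)] with h hh
  obtain ⟨B, hB, hBL⟩ := ((eventually_fullMelnikov_eq hG p h).and
    (eventually_ge_atTop (R + L))).exists
  rw [← hB, melnikov]
  have hi := fun s t => (continuous_melnikov_integrand p G h).intervalIntegrable
    (μ := MeasureTheory.volume) s t
  set S := √(2 * (h + K))
  have hS : 0 < S := Real.sqrt_pos.2 (by linarith)
  have h1 : 0 ≤ ∫ x in (-B)..(-R), p.eval x * √(2 * (h - G.eval x)) :=
    intervalIntegral.integral_nonneg (by linarith) fun x hx =>
      mul_nonneg (by linarith [hR x (by rw [le_abs]; right; linarith [hx.2])]) (Real.sqrt_nonneg _)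
  have h4 : 0 ≤ ∫ x in (R + L)..B, p.eval x * √(2 * (h - G.eval x)) :=
    intervalIntegral.integral_nonneg (by linarith) fun x hx =>
      mul_nonneg (by linarith [hR x (by rw [le_abs]; left; linarith [hx.1])]) (Real.sqrt_nonneg _)
  have h2 : ∫ _ in (-R)..R, -(P * S) ≤ ∫ x in (-R)..R, p.eval x * √(2 * (h - G.eval x)) := by
    refine intervalIntegral.integral_mono_on (by linarith) (by simp) (hi _ _) fun x hx => ?_
    have h5 : √(2 * (h - G.eval x)) ≤ S := Real.sqrt_le_sqrt (by linarith [hK x])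
    have h6 := (abs_le.1 (hP x (abs_le.2 hx))).1
    nlinarith [Real.sqrt_nonneg (2 * (h - G.eval x))]
  have h3 : ∫ _ in R..(R + L), S / 2 ≤ ∫ x in R..(R + L), p.eval x * √(2 * (h - G.eval x)) := by
    refine intervalIntegral.integral_mono_on (by linarith) (by simp) (hi _ _) fun x hx => ?_
    have h5 : S / 2 ≤ √(2 * (h - G.eval x)) := by
      refine Real.le_sqrt_of_sq_le ?_
      have := (abs_le.1 (hK' x (abs_le.2 ⟨by linarith [hx.1], hx.2⟩))).2
      rw [div_pow, Real.sq_sqrt (by linarith)]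
      linarith
    have h6 := hR x (by rw [le_abs]; left; exact hx.1)
    nlinarith [Real.sqrt_nonneg (2 * (h - G.eval x))]
  rw [intervalIntegral.integral_const, smul_eq_mul] at h2 h3
  rw [← intervalIntegral.integral_add_adjacent_intervals (hi (-B) (-R)) (hi _ B),
    ← intervalIntegral.integral_add_adjacent_intervals (hi (-R) R) (hi _ B),
    ← intervalIntegral.integral_add_adjacent_intervals (hi R (R + L)) (hi _ B)]
  have : (R + L - R) * (S / 2) + (R - -R) * -(P * S) = S / 2 := by
    simp only [L]; ring
  linarith

lemma tendsto_cocompact_of_even {p : ℝ[X]} (hp : ∀ x, p.eval (-x) = p.eval x)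
    (ht : Tendsto (fun x => p.eval x) atTop atTop) :
    Tendsto (fun x => p.eval x) (cocompact ℝ) atTop := by
  rw [cocompact_eq_atBot_atTop]
  refine tendsto_sup.2 ⟨?_, ht⟩
  simpa [Function.comp_def, hp] using ht.comp tendsto_neg_atBot_atTop

/-- There are even polynomials of degree at most `2 N` whose Melnikov integrals change sign
`N` times along outer level curves. -/
lemma exists_alternating (hG : Tendsto (fun x => G.eval x) (cocompact ℝ) atTop) (h₀ : ℝ) (N : ℕ) :
    ∃ (e : ℝ[X]) (H : ℕ → ℝ), e.natDegree ≤ 2 * N ∧ (∀ x, e.eval (-x) = e.eval x) ∧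
      h₀ ≤ H 0 ∧ 0 < fullMelnikov e G (H N) ∧ ∀ j < N, H j < H (j + 1) ∧
        fullMelnikov e G (H j) * fullMelnikov e G (H (j + 1)) < 0 := by
  induction N with
  | zero =>
    obtain ⟨h, h1, h2⟩ := ((eventually_fullMelnikov_pos hG (p := 1)
      (.of_forall fun x => by simp)).and (eventually_ge_atTop h₀)).exists
    exact ⟨1, fun _ => h, by simp, by simp, h2, h1, by simp⟩
  | succ N ih =>
    obtain ⟨e, H, hdeg, heven, hH0, hpos, halt⟩ := ih
    set q : ℝ → ℝ[X] := fun t => C (-1) * e + C t * X ^ (2 * (N + 1))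
    have hq : ∀ t h, fullMelnikov (q t) G h =
        -1 * fullMelnikov e G h + t * fullMelnikov (X ^ (2 * (N + 1))) G h := fun t h =>
      fullMelnikov_C_mul_add hG _ _ _ _ _
    have hcont : ∀ h, Continuous fun t => fullMelnikov (q t) G h := fun h => by
      simp only [hq]; fun_prop
    have hev : ∀ᶠ t in 𝓝 (0 : ℝ), fullMelnikov (q t) G (H N) < 0 ∧
        ∀ j ∈ Finset.range N,
          fullMelnikov (q t) G (H j) * fullMelnikov (q t) G (H (j + 1)) < 0 := by
      refine ((hcont _).continuousAt.eventually (gt_mem_nhds ?_)).and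
        ((Filter.eventually_all_finset _).2 fun j hj =>
          ((hcont _).mul (hcont _)).continuousAt.eventually (gt_mem_nhds ?_))
      · simp only [hq]; linarith
      · simp only [Pi.mul_apply, hq]; linarith [(halt j (Finset.mem_range.1 hj)).2]
    obtain ⟨t, ⟨htN, htj⟩, ht0⟩ := ((hev.filter_mono (nhdsWithin_le_nhds (s := Ioi 0))).and
      self_mem_nhdsWithin).exists
    have hqeven : ∀ x, (q t).eval (-x) = (q t).eval x := fun x => by
      simp [q, heven, Even.neg_pow (even_two_mul (N + 1))]
    have hqdeg : (C (-1) * e).degree < (C t * X ^ (2 * (N + 1))).degree := by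
      rw [degree_C_mul_X_pow _ (ne_of_gt ht0)]
      refine (degree_le_of_natDegree_le ((natDegree_C_mul_le _ _).trans hdeg)).trans_lt ?_
      exact_mod_cast (by omega : 2 * N < 2 * (N + 1))
    have hqd : (q t).degree = (2 * (N + 1) : ℕ) := by
      rw [degree_add_eq_right_of_degree_lt hqdeg, degree_C_mul_X_pow _ (ne_of_gt ht0)]
    have hqt : Tendsto (fun x => (q t).eval x) atTop atTop := by
      refine (q t).tendsto_atTop_of_leadingCoeff_nonneg (by rw [hqd]; norm_cast; omega) ?_
      rw [leadingCoeff_add_of_degree_lt hqdeg, leadingCoeff_mul]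
      simpa using le_of_lt ht0
    obtain ⟨h, h1, h2⟩ := ((eventually_fullMelnikov_pos hG
      ((tendsto_cocompact_of_even hqeven hqt).eventually_ge_atTop 1)).and
      (eventually_gt_atTop (H N))).exists
    refine ⟨q t, Function.update H (N + 1) h, natDegree_le_of_degree_le hqd.le, hqeven,
      by simpa using hH0, by simpa using h1, fun j hj => ?_⟩
    rw [Function.update_of_ne (by omega : j ≠ N + 1)]
    rcases (Nat.lt_succ_iff.1 hj).eq_or_lt with rfl | hj
    · simpa using ⟨h2, mul_neg_of_neg_of_pos htN h1⟩
    · rw [Function.update_of_ne (by omega : j + 1 ≠ N + 1)]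
      exact ⟨(halt j hj).1, htj j (Finset.mem_range.2 hj)⟩

/-- Outer level curves of a coercive potential form bands centred at the origin. -/
lemma exists_isBand_outer {g : ℝ[X]} (hG : Tendsto (fun x => G.eval x) (cocompact ℝ) atTop)
    (hg : ∀ᶠ x in cocompact ℝ, 0 < x * g.eval x) :
    ∃ h₀, ∀ h₁ h₂, h₀ ≤ h₁ → h₁ < h₂ → ∀ᶠ B in atTop, IsBand g G 0 (-B) B h₁ h₂ := by
  obtain ⟨R, hR⟩ := (eventually_forall_le_abs hg).exists
  obtain ⟨K, hK0, hK⟩ := exists_abs_le_of_abs_le (φ := fun x => x * g.eval x) (by fun_prop) R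
  obtain ⟨K', hK'0, hK'⟩ := exists_abs_le_of_abs_le G.continuous R
  refine ⟨max (K + K' + 1) (G.eval 0 + 1), fun h₁ h₂ h0 hlt => ?_⟩
  filter_upwards [eventually_le_eval_of_le_abs hG h₂, eventually_gt_atTop 0] with B hB hB0
  refine ⟨by linarith, hB0, hlt, ?_, hB _ (by rw [abs_neg]; exact le_abs_self B),
    hB _ (le_abs_self B), fun x _ h hh hle => ?_⟩
  · linarith [le_max_right (K + K' + 1) (G.eval 0 + 1)]
  · rw [sub_zero]
    rcases le_total R |x| with hx | hx
    · linarith [hR x hx]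
    · linarith [(abs_le.1 (hK x hx)).1, (abs_le.1 (hK' x hx)).2, hh.1,
        le_max_left (K + K' + 1) (G.eval 0 + 1)]

end Outer

/-! ### Doubling families of bands -/

/-- The centre, the horizontal extent and the energy range of a band. -/
structure BandData where
  center : ℝ
  left : ℝ
  right : ℝ
  lo : ℝ
  hi : ℝ

/-- The part of the plane swept by the band. -/
def BandData.region (β : BandData) (G : ℝ[X]) : Set (ℝ × ℝ) :=
  bandRegion G β.left β.right β.lo β.hi

/-- A band on which the Melnikov integral changes sign. -/
structure BandData.IsAlternating (β : BandData) (f g G : ℝ[X]) : Prop where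
  isBand : IsBand g G β.center β.left β.right β.lo β.hi
  sign : melnikov f G β.left β.right β.lo * melnikov f G β.left β.right β.hi < 0

/-- In degree `n` there are `k` disjoint alternating bands, for a potential which increases
to infinity at infinity. -/
def HasBands (n k : ℕ) : Prop :=
  ∃ f g G : ℝ[X], f.natDegree ≤ n ∧ g.natDegree ≤ n ∧ derivative G = g ∧
    Tendsto (fun x => G.eval x) atTop atTop ∧ (∀ᶠ x in atTop, 0 < g.eval x) ∧
    ∃ (ι : Type) (_ : Fintype ι) (β : ι → BandData), Fintype.card ι = k ∧
      (∀ i, (β i).IsAlternating f g G) ∧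
      Pairwise fun i j => Disjoint ((β i).region G) ((β j).region G)

lemma hasBands_zero : HasBands 0 0 :=
  ⟨0, 1, X, by simp, by simp, by simp, by simpa using! tendsto_id, by simp,
    Empty, inferInstance, Empty.elim, rfl, fun i => i.elim, fun i => i.elim⟩

lemma eventually_melnikov_add_sign {f G : ℝ[X]} (e : ℝ[X]) {a b h₁ h₂ : ℝ}
    (h : melnikov f G a b h₁ * melnikov f G a b h₂ < 0) :
    ∀ᶠ δ in 𝓝[>] (0 : ℝ),
      melnikov (f + C δ * e) G a b h₁ * melnikov (f + C δ * e) G a b h₂ < 0 := by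
  simp only [melnikov_add_C_mul]
  have hc : Continuous fun δ : ℝ => (melnikov f G a b h₁ + δ * melnikov e G a b h₁) *
      (melnikov f G a b h₂ + δ * melnikov e G a b h₂) := by fun_prop
  exact (hc.continuousAt.eventually (gt_mem_nhds (by simpa using h))).filter_mono
    nhdsWithin_le_nhds

lemma tendsto_square_cocompact (A : ℝ) :
    Tendsto (fun x : ℝ => x ^ 2 - A) (cocompact ℝ) atTop := by
  have := tendsto_cocompact_of_even (p := X ^ 2 - C A) (by simp)
    (by simpa [sub_eq_add_neg] using
      tendsto_atTop_add_const_right _ (-A) (tendsto_pow_atTop two_ne_zero))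
  simpa using this

lemma HasBands.double {n n' k : ℕ} (h : HasBands n k) (hn : 2 * n + 1 ≤ n') :
    HasBands n' (2 * k + n' / 2) := by
  obtain ⟨f, g, G, hf, hg, hG, hGt, hgpos, ι, _, β, hcard, hβ, hdisj⟩ := h
  obtain ⟨A, hA⟩ := (eventually_all.2 fun i => (hβ i).isBand.eventually_squarePullback).exists
  set G' := G.comp (X ^ 2 - C A)
  set g' := squarePullback A g
  set f₀ := squarePullback A f
  have hG'eval : ∀ x, G'.eval x = G.eval (x ^ 2 - A) := fun x => by simp [G']
  have hG'even : ∀ x, G'.eval (-x) = G'.eval x := fun x => by simp [hG'eval]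
  have hg'odd : ∀ x, g'.eval (-x) = -g'.eval x := fun x => by
    simp only [g', eval_squarePullback, neg_sq]; ring
  have hG't : Tendsto (fun x => G'.eval x) (cocompact ℝ) atTop := by
    simpa only [hG'eval, Function.comp_def] using hGt.comp (tendsto_square_cocompact A)
  have hg'pos : ∀ᶠ x in cocompact ℝ, 0 < x * g'.eval x := by
    filter_upwards [(tendsto_square_cocompact A).eventually hgpos,
      (tendsto_square_cocompact A).eventually (eventually_gt_atTop (-A))] with x h1 h2
    have h3 : 0 < x ^ 2 := by linarith
    simp only [g', eval_squarePullback]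
    nlinarith [mul_pos h3 h1]
  obtain ⟨h₀, hband⟩ := exists_isBand_outer hG't hg'pos
  obtain ⟨T, hT⟩ := (Set.finite_range fun i => (β i).hi).bddAbove
  have hT : ∀ i, (β i).hi ≤ T := fun i => hT (mem_range_self i)
  obtain ⟨e, H, hdeg, heven, hH0, -, halt⟩ := exists_alternating hG't (max h₀ T) (n' / 2)
  have hmono : ∀ i j, i ≤ j → j ≤ n' / 2 → H i ≤ H j := fun i j hij => by
    induction j, hij using Nat.le_induction with
    | base => exact fun _ => le_rfl
    | succ j _ ih => exact fun hj => (ih (by omega)).trans (halt j hj).1.le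
  have hHT : ∀ j, j ≤ n' / 2 → max h₀ T ≤ H j := fun j hj =>
    hH0.trans (hmono 0 j (Nat.zero_le j) hj)
  obtain ⟨B, hB⟩ := (eventually_all.2 fun j : Fin (n' / 2) =>
    (hband (H j) (H (j + 1)) ((le_max_left _ _).trans (hHT j j.2.le)) (halt j j.2).1).and
      ((eventually_fullMelnikov_eq hG't e (H j)).and
        (eventually_fullMelnikov_eq hG't e (H (j + 1))))).exists
  let pos (i : ι) : BandData :=
    ⟨√((β i).center + A), √((β i).left + A), √((β i).right + A), (β i).lo, (β i).hi⟩
  let neg (i : ι) : BandData :=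
    ⟨-√((β i).center + A), -√((β i).right + A), -√((β i).left + A), (β i).lo, (β i).hi⟩
  let new (j : Fin (n' / 2)) : BandData := ⟨0, -B, B, H j, H (j + 1)⟩
  have hsq : ∀ i, √((β i).left + A) ^ 2 - A = (β i).left ∧
      √((β i).right + A) ^ 2 - A = (β i).right := fun i => by
    have h1 := (hA i).1
    have h2 := (hβ i).isBand.left_lt
    have h3 := (hβ i).isBand.lt_right
    rw [Real.sq_sqrt h1.le, Real.sq_sqrt (by linarith)]
    constructor <;> ring
  have hpos : ∀ i, (pos i).IsAlternating f₀ g' G' := fun i => ⟨(hA i).2, by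
    simpa only [pos, f₀, G', melnikov_squarePullback, hsq] using (hβ i).sign⟩
  have hneg : ∀ i, (neg i).IsAlternating f₀ g' G' := fun i => ⟨(hA i).2.mirror hg'odd hG'even, by
    simp only [neg, f₀, G', melnikov_squarePullback, neg_sq, hsq]
    simpa only [melnikov, intervalIntegral.integral_symm (β i).left, neg_mul_neg]
      using (hβ i).sign⟩
  obtain ⟨δ, ⟨hδp, hδn⟩, hδ⟩ := (((eventually_all.2 fun i =>
    eventually_melnikov_add_sign e (hpos i).sign).and (eventually_all.2 fun i =>
    eventually_melnikov_add_sign e (hneg i).sign)).and self_mem_nhdsWithin).exists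
  have hδ : 0 < δ := hδ
  have hnew : ∀ j, (new j).IsAlternating (f₀ + C δ * e) g' G' := fun j => by
    refine ⟨(hB j).1, ?_⟩
    have hz : ∀ h, melnikov f₀ G' (-B) B h = 0 := fun h => by
      simp only [f₀, G', melnikov_squarePullback, neg_sq]
      exact intervalIntegral.integral_same
    simp only [new, melnikov_add_C_mul, hz, (hB j).2.1, (hB j).2.2]
    nlinarith [(halt j j.2).2, mul_pos hδ hδ]
  have hposR : ∀ i p, p ∈ (pos i).region G' →
      0 < p.1 ∧ (p.1 ^ 2 - A, p.2) ∈ (β i).region G ∧ p.2 ^ 2 / 2 + G'.eval p.1 < H 0 :=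
    fun i p hp => by
      obtain ⟨h1, h2⟩ := bandRegion_squarePullback (hA i).1 hp
      exact ⟨h1, h2, hp.2.2.trans_le ((hT i).trans ((le_max_right _ _).trans hH0))⟩
  have hnegR : ∀ i p, p ∈ (neg i).region G' →
      p.1 < 0 ∧ (p.1 ^ 2 - A, p.2) ∈ (β i).region G ∧ p.2 ^ 2 / 2 + G'.eval p.1 < H 0 :=
    fun i p hp => by
      obtain ⟨h1, h2, h3⟩ := hposR i _ (bandRegion_mirror hG'even hp)
      exact ⟨neg_pos.1 h1, by simpa using h2, by simpa only [hG'even] using h3⟩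
  have hnewR : ∀ j p, p ∈ (new j).region G' → H 0 < p.2 ^ 2 / 2 + G'.eval p.1 := fun j p hp =>
    (hmono 0 j (Nat.zero_le _) j.2.le).trans_lt hp.2.1
  have hinj : ∀ i j p, p ∈ (β i).region G → p ∈ (β j).region G → i = j := fun i j p hp hq => by
    by_contra hij
    exact Set.disjoint_left.1 (hdisj hij) hp hq
  refine ⟨f₀ + C δ * e, g', G', ?_, (natDegree_squarePullback_le hg).trans hn,
    derivative_comp_square hG A, hG't.mono_left atTop_le_cocompact, ?_, (ι ⊕ ι) ⊕ Fin (n' / 2),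
    inferInstance, Sum.elim (Sum.elim pos neg) new, ?_, ?_, ?_⟩
  · refine (natDegree_add_le _ _).trans (max_le ((natDegree_squarePullback_le hf).trans hn) ?_)
    exact (natDegree_C_mul_le _ _).trans (hdeg.trans (Nat.mul_div_le n' 2))
  · filter_upwards [hg'pos.filter_mono atTop_le_cocompact, eventually_gt_atTop 0] with x h1 h2
    exact pos_of_mul_pos_right h1 h2.le
  · simp only [Fintype.card_sum, Fintype.card_fin, hcard]; ring
  · rintro ((i | i) | j)
    · exact ⟨(hpos i).isBand, hδp i⟩
    · exact ⟨(hneg i).isBand, hδn i⟩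
    · exact hnew j
  · rintro ((i | i) | i) ((j | j) | j) hij <;> refine Set.disjoint_left.2 fun p hp hq => ?_ <;>
      simp only [Sum.elim_inl, Sum.elim_inr] at hp hq
    · exact hij (by rw [hinj i j _ (hposR i p hp).2.1 (hposR j p hq).2.1])
    · exact (hposR i p hp).1.asymm (hnegR j p hq).1
    · exact (hposR i p hp).2.2.asymm (hnewR j p hq)
    · exact (hposR j p hq).1.asymm (hnegR i p hp).1
    · exact hij (by rw [hinj i j _ (hnegR i p hp).2.1 (hnegR j p hq).2.1])
    · exact (hnegR i p hp).2.2.asymm (hnewR j p hq)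
    · exact (hposR j p hq).2.2.asymm (hnewR i p hp)
    · exact (hnegR j p hq).2.2.asymm (hnewR i p hp)
    · have hp := hp.2
      have hq := hq.2
      simp only [new] at hp hq
      rcases lt_trichotomy i j with h | h | h
      · linarith [hmono (i + 1) j h j.2.le, hp.2, hq.1]
      · exact hij (by rw [h])
      · linarith [hmono (j + 1) i h i.2.le, hp.1, hq.2]

/-! ### Counting limit cycles -/

lemma IsLimitCycle.nonempty {V : ℝ × ℝ → ℝ × ℝ} {Γ : Set (ℝ × ℝ)} (h : IsLimitCycle V Γ) :
    Γ.Nonempty := by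
  obtain ⟨⟨γ, -, -, -, rfl⟩, -⟩ := h
  exact range_nonempty γ

lemma HasBands.hGe {n k : ℕ} (h : HasBands n k) : HGe n n k := by
  obtain ⟨f, g, G, hf, hg, hG, -, -, ι, _, β, hcard, hβ, hdisj⟩ := h
  have hev := eventually_all.2 fun i => (hβ i).isBand.exists_isLimitCycle hG (hβ i).sign
  obtain ⟨u, hu0, hu⟩ := (nhdsGT_basis (0 : ℝ)).eventually_iff.1 hev
  refine ⟨f, g, hf, hg, u / 2, half_pos hu0, fun ε h1 h2 => ?_⟩
  choose Γ hΓ hΓβ using hu (show ε ∈ Ioo 0 u from ⟨h1, by linarith⟩)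
  have hinj : Function.Injective Γ := fun i j hij => by
    by_contra hne
    obtain ⟨p, hp⟩ := (hΓ i).nonempty
    exact Set.disjoint_left.1 (hdisj hne) (hΓβ i hp) (hΓβ j (hij ▸ hp))
  classical
  refine ⟨Finset.univ.image Γ, by simpa using hΓ, ?_⟩
  rw [Finset.card_image_of_injective _ hinj, Finset.card_univ, hcard]

/-- The number of limit cycles obtained by repeated doubling. -/
def bandCount : ℕ → ℕ
  | 0 => 0
  | m + 1 => 2 * bandCount (m / 2) + (m + 1) / 2

lemma hasBands_bandCount (m : ℕ) : HasBands m (bandCount m) := by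
  induction m using Nat.strong_induction_on with
  | _ m ih =>
    cases m with
    | zero => rw [bandCount]; exact hasBands_zero
    | succ m =>
      rw [bandCount]
      exact (ih (m / 2) (by omega)).double (by omega)

lemma le_bandCount (j m : ℕ) : (m + 2) * j + 3 ≤ 2 * bandCount m + 3 * 2 ^ j := by
  induction j generalizing m with
  | zero => simp
  | succ j ih =>
    cases m with
    | zero =>
      rw [bandCount]
      have : j + 1 ≤ 2 ^ j := Nat.lt_two_pow_self
      rw [pow_succ]; omega
    | succ m =>
      rw [bandCount]
      have h1 := ih (m / 2)
      have h2 : (m + 1 + 2) * j ≤ 2 * ((m / 2 + 2) * j) := by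
        rw [← mul_assoc]; exact Nat.mul_le_mul_right j (by omega)
      have h3 : m ≤ 2 * ((m + 1) / 2) := by omega
      rw [pow_succ]
      linarith

lemma HGe.mono {n m : ℕ} {c c' : ℝ} (h : HGe n m c) (hc : c' ≤ c) : HGe n m c' := by
  obtain ⟨f, g, hf, hg, ε₀, hε₀, H⟩ := h
  refine ⟨f, g, hf, hg, ε₀, hε₀, fun ε h1 h2 => ?_⟩
  obtain ⟨S, hS, hcS⟩ := H ε h1 h2
  exact ⟨S, hS, hc.trans hcS⟩

lemma mul_log_le_bandCount (m : ℕ) :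
    ((m : ℝ) + 2) * (Real.log (m + 2) / (2 * Real.log 2) - 2) ≤ bandCount m := by
  set j := Nat.log 2 (m + 2)
  have h1 : 2 ^ j ≤ m + 2 := Nat.pow_log_le_self 2 (by omega)
  have h2 : m + 2 < 2 ^ (j + 1) := Nat.lt_pow_succ_log_self one_lt_two _
  have h3 : ((m : ℝ) + 2) * j + 3 ≤ 2 * bandCount m + 3 * 2 ^ j := by
    exact_mod_cast le_bandCount j m
  have h4 : (2 : ℝ) ^ j ≤ m + 2 := by exact_mod_cast h1
  have h5 : (m : ℝ) + 2 < 2 ^ (j + 1) := by exact_mod_cast h2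
  have h6 : Real.log (m + 2) / Real.log 2 ≤ j + 1 := by
    rw [div_le_iff₀ (Real.log_pos one_lt_two)]
    have := Real.log_le_log (by positivity) h5.le
    rw [Real.log_pow] at this
    exact_mod_cast this
  have h7 : Real.log (m + 2) / (2 * Real.log 2) = Real.log (m + 2) / Real.log 2 / 2 := by
    rw [div_div, mul_comm]
  rw [h7]
  nlinarith [Nat.cast_nonneg (α := ℝ) m]

theorem stmt11 (c : ℝ) (hc : c < 1 / (2 * Real.log 2)) :
    ∃ M : ℕ, ∀ m : ℕ, M ≤ m →
      HGe m m (c * ((m : ℝ) + 2) * Real.log ((m : ℝ) + 2)) := by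
  have ht : Tendsto (fun m : ℕ => (1 / (2 * Real.log 2) - c) * Real.log ((m : ℝ) + 2)) atTop
      atTop := (Real.tendsto_log_atTop.comp
    (tendsto_atTop_add_const_right _ 2 tendsto_natCast_atTop_atTop)).const_mul_atTop (by linarith)
  obtain ⟨M, hM⟩ := eventually_atTop.1 (ht.eventually_ge_atTop 2)
  refine ⟨M, fun m hm => (hasBands_bandCount m).hGe.mono ?_⟩
  refine le_trans ?_ (mul_log_le_bandCount m)
  have h1 := hM m hm
  have h2 : (0 : ℝ) ≤ m + 2 := by positivity
  calc c * ((m : ℝ) + 2) * Real.log (m + 2) = (m + 2) * (c * Real.log (m + 2)) := by ring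
    _ ≤ _ := mul_le_mul_of_nonneg_left (by rw [sub_mul, one_div_mul_eq_div] at h1; linarith) h2
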